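/- Let ν ≥ 0 and let u be a solution on ℝ² of Δu + f_τ(u) = 4πν δ₀ (i.e. u is smooth on ℝ²∖{0}, u(x) − 2ν ln|x| extends smoothly across 0, and Δu + f_τ(u) = 0 classically on ℝ²∖{0}), with f_τ(u) ∈ L¹(ℝ²) and lim_{|x|→∞} u(x) = −∞. Then u is unstable: inf{ ∫_{ℝ²} (|∇φ|² − f_τ'(u) φ²) dx : φ ∈ C_c^∞(ℝ²∖{0}), ∫_{ℝ²} φ² dx = 1 } < 0, where f_τ'(t) = e^t(τ − 2(τ+1)e^t + e^{2t})/(τ+e^t)^4. -/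

import Mathlib

open MeasureTheory Real Filter Set Metric Topology

noncomputable section

/-- The Euclidean plane `ℝ²`. -/
abbrev Pl := EuclideanSpace ℝ (Fin 2)

/-- The unit lattice `ℤ² ⊆ ℝ²`; the flat 2-torus `Ω` is its quotient, which we model by
working with doubly periodic functions on the plane. -/
def unitLattice : Set Pl :=
  {v | ∃ a b : ℤ, v = (a : ℝ) • EuclideanSpace.single 0 (1:ℝ) +
      (b : ℝ) • EuclideanSpace.single 1 (1:ℝ)}

/-- A fundamental domain for the torus `Ω` (of total area `|Ω| = 1`). -/
def fund : Set Pl := {x | x 0 ∈ Ico (0:ℝ) 1 ∧ x 1 ∈ Ico (0:ℝ) 1}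

/-- A doubly periodic function on the plane, i.e. a function on the torus `Ω`. -/
def Periodic2 (u : Pl → ℝ) : Prop := ∀ x : Pl, ∀ v ∈ unitLattice, u (x + v) = u x

/-- Partial derivative in the `i`-th coordinate direction. -/
def pd (u : Pl → ℝ) (i : Fin 2) : Pl → ℝ :=
  fun x => lineDeriv ℝ u x (EuclideanSpace.single i (1:ℝ))

/-- The Laplacian `Δu`. -/
def lap (u : Pl → ℝ) (x : Pl) : ℝ := pd (pd u 0) 0 x + pd (pd u 1) 1 x

/-- `|∇u|²`. -/
def gradSq (u : Pl → ℝ) (x : Pl) : ℝ := (pd u 0 x) ^ 2 + (pd u 1 x) ^ 2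

/-- The nonlinearity `f_τ(t) = e^t (1 − e^t) / (τ + e^t)³`. -/
def fτ (τ t : ℝ) : ℝ := exp t * (1 - exp t) / (τ + exp t) ^ 3

/-- `f_τ'(t) = e^t (τ − 2(τ+1) e^t + e^{2t}) / (τ + e^t)⁴`. -/
def fτ' (τ t : ℝ) : ℝ := exp t * (τ - 2 * (τ + 1) * exp t + exp (2 * t)) / (τ + exp t) ^ 4

/-- The antiderivative `F_{2,τ}(t) = e^t ((1−τ) e^t + 2τ) / (2τ² (τ+e^t)²)` of `f_τ`. -/
def F2τ (τ t : ℝ) : ℝ := exp t * ((1 - τ) * exp t + 2 * τ) / (2 * τ ^ 2 * (τ + exp t) ^ 2)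

/-- `u − 2a ln‖· − p‖` extends smoothly across `p`: this encodes the distributional
equation `Δu = 4πa δ_p + (smooth)` near `p`. -/
def LogSing (u : Pl → ℝ) (p : Pl) (a : ℝ) : Prop :=
  ∃ r > 0, ∃ v : Pl → ℝ, ContDiffOn ℝ (⊤ : ℕ∞) v (ball p r) ∧
    ∀ x ∈ ball p r, x ≠ p → u x = 2 * a * Real.log ‖x - p‖ + v x

/-- The vortex data: distinct points `p_{j,1}` (`1 ≤ j ≤ d₁`), `p_{j,2}` (`1 ≤ j ≤ d₂`)
of the torus with multiplicities `m_{j,1} ≥ 0`, `m_{j,2} ≥ 0`. -/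
structure VortexData where
  d₁ : ℕ
  d₂ : ℕ
  p₁ : Fin d₁ → Pl
  p₂ : Fin d₂ → Pl
  m₁ : Fin d₁ → ℝ
  m₂ : Fin d₂ → ℝ
  m₁_nonneg : ∀ j, 0 ≤ m₁ j
  m₂_nonneg : ∀ j, 0 ≤ m₂ j
  distinct : ∀ i j : Fin d₁ ⊕ Fin d₂, i ≠ j → ∀ v ∈ unitLattice,
      Sum.elim p₁ p₂ i ≠ Sum.elim p₁ p₂ j + v

namespace VortexData
variable (V : VortexData)

/-- The set `Z₁` of vortex points `p_{j,1}` (viewed in the plane: all lattice translates). -/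
def Z1 : Set Pl := {x | ∃ j v, v ∈ unitLattice ∧ x = V.p₁ j + v}

/-- The set `Z₂` of vortex points `p_{j,2}` (viewed in the plane: all lattice translates). -/
def Z2 : Set Pl := {x | ∃ j v, v ∈ unitLattice ∧ x = V.p₂ j + v}

/-- The full vortex set `Z = Z₁ ∪ Z₂`. -/
def Z : Set Pl := V.Z1 ∪ V.Z2

/-- `N₁ = Σ_j m_{j,1}`. -/
def N1 : ℝ := ∑ j, V.m₁ j

/-- `N₂ = Σ_j m_{j,2}`. -/
def N2 : ℝ := ∑ j, V.m₂ j

end VortexData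

/-- `u` is a solution of `(E_ε)`:
`Δu + ε⁻² f_τ(u) = 4π Σ_j m_{j,1} δ_{p_{j,1}} − 4π Σ_j m_{j,2} δ_{p_{j,2}}` on `Ω`,
formulated classically: `u` is doubly periodic, smooth away from `Z`, solves the PDE
classically off `Z`, and has the prescribed logarithmic singularities at the vortices. -/
structure IsSolution (V : VortexData) (τ ε : ℝ) (u : Pl → ℝ) : Prop where
  periodic : Periodic2 u
  smooth : ContDiffOn ℝ (⊤ : ℕ∞) u (V.Z)ᶜ
  pde : ∀ x ∉ V.Z, lap u x + (ε ^ 2)⁻¹ * fτ τ (u x) = 0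
  sing₁ : ∀ j, LogSing u (V.p₁ j) (V.m₁ j)
  sing₂ : ∀ j, LogSing u (V.p₂ j) (-(V.m₂ j))

/-- The quadratic form `∫_Ω |∇φ|² − ε⁻² f_τ'(u) φ²` of the linearized operator at `u`. -/
def QuadForm (τ ε : ℝ) (u φ : Pl → ℝ) : ℝ :=
  ∫ x in fund, (gradSq φ x - (ε ^ 2)⁻¹ * fτ' τ (u x) * (φ x) ^ 2)

/-- `u` is a stable solution: the first eigenvalue `μ_ε` of the linearized operator is
nonnegative, i.e. the quadratic form is nonnegative on all (smooth, doubly periodic)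
test functions. -/
def Stable (τ ε : ℝ) (u : Pl → ℝ) : Prop :=
  ∀ φ : Pl → ℝ, ContDiff ℝ (⊤ : ℕ∞) φ → Periodic2 φ → 0 ≤ QuadForm τ ε u φ

/-- `u` is strictly stable: the first eigenvalue `μ_ε` of the linearized operator is
strictly positive. -/
def StrictlyStable (τ ε : ℝ) (u : Pl → ℝ) : Prop :=
  ∃ μ > 0, ∀ φ : Pl → ℝ, ContDiff ℝ (⊤ : ℕ∞) φ → Periodic2 φ →
    μ * (∫ x in fund, (φ x) ^ 2) ≤ QuadForm τ ε u φ

/-! ### Calculus of partial derivatives -/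

lemma pd_eq {u : Pl → ℝ} {x : Pl} (hu : DifferentiableAt ℝ u x) (i : Fin 2) :
    pd u i x = fderiv ℝ u x (EuclideanSpace.single i (1:ℝ)) :=
  hu.lineDeriv_eq_fderiv

lemma pd_congr {u v : Pl → ℝ} {x : Pl} (h : u =ᶠ[𝓝 x] v) (i : Fin 2) : pd u i x = pd v i x :=
  h.lineDeriv_eq

lemma pd_congr_ev {u v : Pl → ℝ} {x : Pl} (h : u =ᶠ[𝓝 x] v) (i : Fin 2) :
    pd u i =ᶠ[𝓝 x] pd v i := by
  filter_upwards [h.eventuallyEq_nhds] with y hy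
  exact pd_congr hy i

lemma pd_mul {u v : Pl → ℝ} {x : Pl} (hu : DifferentiableAt ℝ u x) (hv : DifferentiableAt ℝ v x)
    (i : Fin 2) : pd (fun y => u y * v y) i x = pd u i x * v x + u x * pd v i x := by
  rw [pd_eq (u := fun y => u y * v y) (hu.mul hv), pd_eq hu, pd_eq hv, fderiv_fun_mul hu hv]
  simp; ring

lemma pd_add {u v : Pl → ℝ} {x : Pl} (hu : DifferentiableAt ℝ u x) (hv : DifferentiableAt ℝ v x)
    (i : Fin 2) : pd (fun y => u y + v y) i x = pd u i x + pd v i x := by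
  rw [pd_eq (u := fun y => u y + v y) (hu.add hv), pd_eq hu, pd_eq hv, fderiv_fun_add hu hv]
  simp

lemma pd_neg {u : Pl → ℝ} {x : Pl} (hu : DifferentiableAt ℝ u x)
    (i : Fin 2) : pd (fun y => - u y) i x = - pd u i x := by
  rw [pd_eq (u := fun y => - u y) hu.neg, pd_eq hu, fderiv_fun_neg]
  simp

lemma pd_const (c : ℝ) (x : Pl) (i : Fin 2) : pd (fun _ => c) i x = 0 := by
  rw [pd_eq (differentiableAt_const c)]; simp

lemma pd_comp {u : Pl → ℝ} {g : ℝ → ℝ} {g' : ℝ} {x : Pl} (hu : DifferentiableAt ℝ u x)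
    (hg : HasDerivAt g g' (u x)) (i : Fin 2) : pd (fun y => g (u y)) i x = g' * pd u i x := by
  have h := hg.comp_hasFDerivAt x hu.hasFDerivAt
  rw [pd_eq (u := fun y => g (u y)) h.differentiableAt, pd_eq hu]
  have := h.fderiv
  simp only [Function.comp_def] at this
  rw [this]; simp

lemma hasFDerivAt_coord (x : Pl) (j : Fin 2) :
    HasFDerivAt (fun y : Pl => y j) (EuclideanSpace.proj j : Pl →L[ℝ] ℝ) x :=
  (EuclideanSpace.proj j : Pl →L[ℝ] ℝ).hasFDerivAt

lemma contDiff_coord {n : WithTop ℕ∞} (j : Fin 2) : ContDiff ℝ n (fun y : Pl => y j) :=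
  (EuclideanSpace.proj j : Pl →L[ℝ] ℝ).contDiff

lemma pd_coord (x : Pl) (i j : Fin 2) : pd (fun y : Pl => y j) i x = if i = j then 1 else 0 := by
  rw [pd_eq (hasFDerivAt_coord x j).differentiableAt, (hasFDerivAt_coord x j).fderiv]
  simp [eq_comm]

lemma contDiffAt_pd {u : Pl → ℝ} {x : Pl} {m n : WithTop ℕ∞} (hu : ContDiffAt ℝ n u x)
    (hmn : m + 1 ≤ n) (i : Fin 2) : ContDiffAt ℝ m (pd u i) x := by
  have h1 : ContDiffAt ℝ 1 u x := hu.of_le (le_trans (by simp) hmn)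
  have h2 : ∀ᶠ y in 𝓝 x, DifferentiableAt ℝ u y :=
    (h1.eventually (by simp)).mono fun y hy => hy.differentiableAt (by simp)
  have h3 : pd u i =ᶠ[𝓝 x] fun y => fderiv ℝ u y (EuclideanSpace.single i (1:ℝ)) :=
    h2.mono fun y hy => pd_eq hy i
  exact ((hu.fderiv_right hmn).clm_apply contDiffAt_const).congr_of_eventuallyEq h3

lemma smoothAt_pd {u : Pl → ℝ} {x : Pl} (hu : ContDiffAt ℝ (⊤ : ℕ∞) u x) (i : Fin 2) :
    ContDiffAt ℝ (⊤ : ℕ∞) (pd u i) x := contDiffAt_pd hu (by exact_mod_cast le_refl _) i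

lemma smooth_pd {u : Pl → ℝ} (hu : ContDiff ℝ (⊤ : ℕ∞) u) (i : Fin 2) :
    ContDiff ℝ (⊤ : ℕ∞) (pd u i) :=
  contDiff_iff_contDiffAt.2 fun x => smoothAt_pd hu.contDiffAt i

lemma smoothAt_diff {u : Pl → ℝ} {x : Pl} (hu : ContDiffAt ℝ (⊤ : ℕ∞) u x) :
    DifferentiableAt ℝ u x := hu.differentiableAt (by simp)

/-- Symmetry of second derivatives. -/
lemma pd_comm {u : Pl → ℝ} {x : Pl} (hu : ContDiffAt ℝ (⊤ : ℕ∞) u x) (i j : Fin 2) :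
    pd (pd u i) j x = pd (pd u j) i x := by
  have h1 : ContDiffAt ℝ 1 u x := hu.of_le (by simp)
  have h2 : ∀ᶠ y in 𝓝 x, DifferentiableAt ℝ u y :=
    (h1.eventually (by simp)).mono fun y hy => hy.differentiableAt (by simp)
  have h3 : ∀ k, pd u k =ᶠ[𝓝 x] fun y => fderiv ℝ u y (EuclideanSpace.single k (1:ℝ)) :=
    fun k => h2.mono fun y hy => pd_eq hy k
  have hd : DifferentiableAt ℝ (fderiv ℝ u) x :=
    (hu.fderiv_right (m := 1) (by norm_cast)).differentiableAt (by simp)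
  have key : ∀ k l, pd (pd u k) l x =
      fderiv ℝ (fderiv ℝ u) x (EuclideanSpace.single l (1:ℝ)) (EuclideanSpace.single k (1:ℝ)) := by
    intro k l
    rw [pd_congr (h3 k), pd_eq (hd.clm_apply (differentiableAt_const _)),
      fderiv_clm_apply hd (differentiableAt_const _)]
    simp
  rw [key, key]
  exact (hu.isSymmSndFDerivAt (by simp only [minSmoothness_of_isRCLikeNormedField]; exact WithTop.coe_le_coe.2 (le_top : (2:ℕ∞) ≤ ⊤))) _ _

lemma smoothAt_pd2 {u : Pl → ℝ} {x : Pl} (hu : ContDiffAt ℝ (⊤ : ℕ∞) u x) (i j : Fin 2) :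
    DifferentiableAt ℝ (pd (pd u i) j) x := smoothAt_diff (smoothAt_pd (smoothAt_pd hu i) j)

lemma smoothAt_ev {u : Pl → ℝ} (hsm : ContDiffOn ℝ (⊤ : ℕ∞) u {(0:Pl)}ᶜ) {x : Pl} (hx : x ≠ 0) :
    ContDiffAt ℝ (⊤ : ℕ∞) u x := hsm.contDiffAt (isOpen_compl_singleton.mem_nhds hx)

/-- The integral of a partial derivative of a compactly supported function vanishes. -/
lemma integral_pd_eq_zero {F : Pl → ℝ} (hF : ContDiff ℝ 1 F) (hc : HasCompactSupport F)
    (i : Fin 2) : ∫ x, pd F i x = 0 := by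
  have hd : ∀ x, DifferentiableAt ℝ F x := fun x => hF.contDiffAt.differentiableAt (by simp)
  have h0 : pd F i = fun x => fderiv ℝ F x (EuclideanSpace.single i (1:ℝ)) := by
    funext x; exact pd_eq (hd x) i
  have hcont : Continuous (pd F i) := by
    rw [h0]; exact (hF.continuous_fderiv (by simp)).clm_apply continuous_const
  have hcs : HasCompactSupport (pd F i) := by
    rw [h0]; exact (hc.fderiv (𝕜 := ℝ)).comp_left (g := fun L : Pl →L[ℝ] ℝ => L (EuclideanSpace.single i (1:ℝ))) (by simp)
  have := integral_bilinear_hasLineDerivAt_right_eq_neg_left_of_integrable (μ := (volume : Measure Pl))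
    (f := fun _ : Pl => (1:ℝ)) (f' := fun _ => (0:ℝ)) (g := F) (g' := pd F i)
    (v := EuclideanSpace.single i (1:ℝ)) (B := ContinuousLinearMap.mul ℝ ℝ)
    (by simp) (by simpa using hcont.integrable_of_hasCompactSupport hcs)
    (by simpa using hF.continuous.integrable_of_hasCompactSupport hc)
    (by intro x _; simpa using (hasFDerivAt_const (𝕜 := ℝ) (1:ℝ) x).hasLineDerivAt (EuclideanSpace.single i (1:ℝ)))
    (by intro x _; exact (hd x).lineDifferentiableAt.hasLineDerivAt)
  simpa using this

/-! ### A smooth convex approximation of the positive part -/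

lemma zero_of_neg {h : ℝ → ℝ} (hc : Continuous h) (h0 : ∀ s < 0, h s = 0) : h 0 = 0 := by
  have h1 : Tendsto h (𝓝[<] 0) (𝓝 (h 0)) := hc.continuousAt.tendsto.mono_left nhdsWithin_le_nhds
  have h2 : Tendsto h (𝓝[<] 0) (𝓝 0) :=
    tendsto_const_nhds.congr' (by filter_upwards [self_mem_nhdsWithin] with s hs using (h0 s hs).symm)
  exact tendsto_nhds_unique h1 h2

lemma exists_G (δ : ℝ) (hδ : 0 < δ) : ∃ G : ℝ → ℝ, ContDiff ℝ (⊤ : ℕ∞) G ∧ (∀ s ≤ 0, G s = 0) ∧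
    (∀ s, 0 ≤ G s ∧ G s ≤ max s 0 ∧ 0 ≤ deriv G s ∧ deriv G s ≤ 1 ∧ 0 ≤ s * deriv G s - G s ∧
      s * deriv G s - G s ≤ δ * deriv G s ∧ 0 ≤ deriv (deriv G) s) ∧
    (∀ s, δ ≤ s → s * exp (-1) ≤ G s ∧ exp (-1) ≤ deriv G s) := by
  set G : ℝ → ℝ := fun s => s * expNegInvGlue (s / δ) with hG
  have hsm : ContDiff ℝ (⊤ : ℕ∞) G := contDiff_id.mul (expNegInvGlue.contDiff.comp (contDiff_id.div_const δ))
  have hpos : ∀ s, 0 < s → G s = s * exp (-(δ / s)) := by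
    intro s hs
    have : ¬ (s / δ ≤ 0) := not_le.2 (by positivity)
    simp [hG, expNegInvGlue, this]
  have hneg : ∀ s ≤ 0, G s = 0 := by
    intro s hs
    have : s / δ ≤ 0 := div_nonpos_of_nonpos_of_nonneg hs hδ.le
    simp [hG, expNegInvGlue.zero_of_nonpos this]
  have hsm1 : ContDiff ℝ (⊤ : ℕ∞) (deriv G) := hsm.deriv' 
  have hc1 : Continuous (deriv G) := hsm1.continuous
  have hc2 : Continuous (deriv (deriv G)) := hsm1.continuous_deriv (by simp)
  have hE : ∀ s, 0 < s → HasDerivAt (fun s => exp (-(δ / s))) (exp (-(δ/s)) * (δ / s^2)) s := by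
    intro s hs
    have h1 : HasDerivAt (fun s : ℝ => -(δ / s)) (δ / s^2) s := by
      have := ((hasDerivAt_inv hs.ne').const_mul δ).neg
      refine (this.congr_deriv ?_).congr_of_eventuallyEq ?_
      · field_simp
      · exact Eventually.of_forall fun y => by simp [div_eq_mul_inv]
    exact h1.exp
  have hd1 : ∀ s, 0 < s → HasDerivAt G (exp (-(δ/s)) * (1 + δ / s)) s := by
    intro s hs
    have := (hasDerivAt_id s).mul (hE s hs)
    refine (this.congr_deriv ?_).congr_of_eventuallyEq ?_
    · simp; field_simp
    · filter_upwards [lt_mem_nhds hs] with y hy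
      simp [hpos y hy]
  have hd2 : ∀ s, 0 < s → HasDerivAt (deriv G) (exp (-(δ/s)) * (δ^2 / s^3)) s := by
    intro s hs
    have h1 : HasDerivAt (fun s : ℝ => 1 + δ / s) (-(δ / s^2)) s := by
      have := ((hasDerivAt_inv hs.ne').const_mul δ).const_add 1
      refine (this.congr_deriv ?_).congr_of_eventuallyEq ?_
      · field_simp
      · exact Eventually.of_forall fun y => by simp [div_eq_mul_inv]
    have := (hE s hs).mul h1
    refine (this.congr_deriv ?_).congr_of_eventuallyEq ?_
    · field_simp; ring
    · filter_upwards [lt_mem_nhds hs] with y hy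
      simp [(hd1 y hy).deriv]
  have hn1 : ∀ s < 0, deriv G s = 0 := by
    intro s hs
    have : G =ᶠ[𝓝 s] fun _ => 0 := by
      filter_upwards [gt_mem_nhds hs] with y hy using hneg y hy.le
    rw [this.deriv_eq]; simp
  have hn2 : ∀ s < 0, deriv (deriv G) s = 0 := by
    intro s hs
    have : deriv G =ᶠ[𝓝 s] fun _ => 0 := by
      filter_upwards [gt_mem_nhds hs] with y hy using hn1 y hy
    rw [this.deriv_eq]; simp
  have hn1' : ∀ s ≤ 0, deriv G s = 0 := by
    intro s hs
    rcases hs.lt_or_eq with h | rfl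
    · exact hn1 s h
    · exact zero_of_neg hc1 hn1
  have hn2' : ∀ s ≤ 0, deriv (deriv G) s = 0 := by
    intro s hs
    rcases hs.lt_or_eq with h | rfl
    · exact hn2 s h
    · exact zero_of_neg hc2 hn2
  refine ⟨G, hsm, hneg, ?_, ?_⟩
  · intro s
    rcases le_or_gt s 0 with h | h
    · simp [hneg s h, hn1' s h, hn2' s h]
    · rw [hpos s h, (hd1 s h).deriv, (hd2 s h).deriv, max_eq_left h.le]
      have e0 := exp_pos (-(δ/s))
      have y0 : 0 < δ / s := by positivity
      have e1 : exp (-(δ/s)) ≤ 1 := exp_le_one_iff.2 (by linarith)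
      have e2 : exp (-(δ/s)) * (1 + δ/s) ≤ 1 := by
        have := add_one_le_exp (δ/s)
        calc exp (-(δ/s)) * (1 + δ/s) ≤ exp (-(δ/s)) * exp (δ/s) := by gcongr; linarith
          _ = 1 := by rw [← exp_add]; simp
      have e3 : s * (exp (-(δ/s)) * (1 + δ/s)) - s * exp (-(δ/s)) = δ * exp (-(δ/s)) := by
        field_simp; ring
      refine ⟨by positivity, by nlinarith, by positivity, e2, ?_, ?_, by positivity⟩
      · rw [e3]; positivity
      · rw [e3]
        have : exp (-(δ/s)) * 1 ≤ exp (-(δ/s)) * (1 + δ/s) := by gcongr; linarith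
        nlinarith
  · intro s hs
    have h : 0 < s := hδ.trans_le hs
    rw [hpos s h, (hd1 s h).deriv]
    have y0 : 0 < δ / s := by positivity
    have y1 : δ / s ≤ 1 := (div_le_one h).2 hs
    have e1 : exp (-1) ≤ exp (-(δ/s)) := exp_le_exp.2 (by linarith)
    refine ⟨by gcongr, ?_⟩
    have := exp_pos (-(δ/s))
    nlinarith

/-! ### The nonlinearity -/

lemma hasDerivAt_fτ (τ : ℝ) (hτ : 0 < τ) (t : ℝ) : HasDerivAt (fτ τ) (fτ' τ t) t := by
  have hp : τ + exp t ≠ 0 := by positivity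
  have h1 := ((Real.hasDerivAt_exp t).mul ((Real.hasDerivAt_exp t).const_sub 1)).div
    (((Real.hasDerivAt_exp t).const_add τ).pow 3) (pow_ne_zero 3 hp)
  refine (h1.congr_deriv ?_).congr_of_eventuallyEq ?_
  · simp only [fτ', Pi.pow_apply, Pi.mul_apply]
    have : exp (2 * t) = exp t ^ 2 := by rw [← exp_nat_mul]; norm_num
    rw [this]
    field_simp
    push_cast
    ring
  · exact Eventually.of_forall fun y => rfl

lemma fτ_nonneg {τ : ℝ} (hτ : 0 < τ) {t : ℝ} (ht : t ≤ 0) : 0 ≤ fτ τ t := by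
  have : exp t ≤ 1 := exp_le_one_iff.2 ht
  have h2 : 0 ≤ 1 - exp t := by linarith
  unfold fτ; positivity

lemma fτ_pos {τ : ℝ} (hτ : 0 < τ) {t : ℝ} (ht : t < 0) : 0 < fτ τ t := by
  have : exp t < 1 := by rw [← Real.exp_zero]; exact exp_lt_exp.2 ht
  have h2 : 0 < 1 - exp t := by linarith
  unfold fτ; positivity

lemma fτ_neg {τ : ℝ} (hτ : 0 < τ) {t : ℝ} (ht : 0 < t) : fτ τ t < 0 := by
  have h2 : 1 - exp t < 0 := by have := Real.one_lt_exp_iff.2 ht; linarith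
  unfold fτ
  apply div_neg_of_neg_of_pos _ (by positivity)
  exact mul_neg_of_pos_of_neg (exp_pos t) h2

lemma continuous_fτ {τ : ℝ} (hτ : 0 < τ) : Continuous (fτ τ) :=
  continuous_iff_continuousAt.2 fun t => (hasDerivAt_fτ τ hτ t).continuousAt

lemma continuous_fτ' {τ : ℝ} (hτ : 0 < τ) : Continuous (fτ' τ) := by
  unfold fτ'
  refine Continuous.div (by fun_prop) (by fun_prop) fun t => ?_
  have : 0 < τ + exp t := by positivity
  positivity

lemma fτ'_bound {τ : ℝ} (hτ : 0 < τ) {t : ℝ} (ht : t ≤ 0) : |fτ' τ t| ≤ (3 * τ + 3) / τ ^ 4 := by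
  have h1 : exp t ≤ 1 := exp_le_one_iff.2 ht
  have h0 := exp_pos t
  have h2 : exp (2 * t) = exp t ^ 2 := by rw [← exp_nat_mul]; norm_num
  unfold fτ'
  rw [abs_div, abs_of_pos (a := (τ + exp t)^4) (by positivity), abs_mul, abs_of_pos h0, h2]
  have h4 : |τ - 2 * (τ + 1) * exp t + exp t ^ 2| ≤ 3 * τ + 3 := by
    rw [abs_le]; constructor <;> nlinarith
  have h3 : τ ^ 4 ≤ (τ + exp t)^4 := by gcongr; linarith
  gcongr
  nlinarith [abs_nonneg (τ - 2 * (τ + 1) * exp t + exp t ^ 2)]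

/-! ### The function `w = x · ∇u` -/

/-- `x · ∇u`. -/
def wf (u : Pl → ℝ) : Pl → ℝ := fun x => x 0 * pd u 0 x + x 1 * pd u 1 x

lemma smoothAt_wf {u : Pl → ℝ} {x : Pl} (hu : ContDiffAt ℝ (⊤ : ℕ∞) u x) :
    ContDiffAt ℝ (⊤ : ℕ∞) (wf u) x :=
  ((contDiff_coord 0).contDiffAt.mul (smoothAt_pd hu 0)).add
    ((contDiff_coord 1).contDiffAt.mul (smoothAt_pd hu 1))

lemma diff_coord (x : Pl) (j : Fin 2) : DifferentiableAt ℝ (fun y : Pl => y j) x :=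
  (hasFDerivAt_coord x j).differentiableAt

lemma pd_wf {u : Pl → ℝ} {x : Pl} (hu : ContDiffAt ℝ (⊤ : ℕ∞) u x) (i : Fin 2) :
    pd (wf u) i x = pd u i x + (x 0 * pd (pd u 0) i x + x 1 * pd (pd u 1) i x) := by
  have d0 := smoothAt_diff (smoothAt_pd hu 0)
  have d1 := smoothAt_diff (smoothAt_pd hu 1)
  unfold wf
  rw [pd_add ((diff_coord x 0).fun_mul d0) ((diff_coord x 1).fun_mul d1),
    pd_mul (diff_coord x 0) d0, pd_mul (diff_coord x 1) d1, pd_coord, pd_coord]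
  fin_cases i <;> simp <;> ring

lemma smooth_ev {u : Pl → ℝ} {s : Set Pl} (hs : IsOpen s) (hsm : ContDiffOn ℝ (⊤ : ℕ∞) u s) {x : Pl}
    (hx : x ∈ s) : ∀ᶠ y in 𝓝 x, ContDiffAt ℝ (⊤ : ℕ∞) u y := by
  filter_upwards [hs.mem_nhds hx] with y hy
  exact hsm.contDiffAt (hs.mem_nhds hy)

lemma pd_pd_wf {u : Pl → ℝ} {x : Pl} (hu : ∀ᶠ y in 𝓝 x, ContDiffAt ℝ (⊤ : ℕ∞) u y) (i : Fin 2) :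
    pd (pd (wf u) i) i x = 2 * pd (pd u i) i x +
      (x 0 * pd (pd (pd u i) i) 0 x + x 1 * pd (pd (pd u i) i) 1 x) := by
  have hux := hu.self_of_nhds
  have e : pd (wf u) i =ᶠ[𝓝 x]
      fun y => pd u i y + (y 0 * pd (pd u i) 0 y + y 1 * pd (pd u i) 1 y) := by
    filter_upwards [hu] with y hy
    rw [pd_wf hy, pd_comm hy 0 i, pd_comm hy 1 i]
  have d := smoothAt_diff (smoothAt_pd hux i)
  have d0 := smoothAt_pd2 hux i 0
  have d1 := smoothAt_pd2 hux i 1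
  rw [pd_congr e, pd_add d (((diff_coord x 0).fun_mul d0).fun_add ((diff_coord x 1).fun_mul d1)),
    pd_add ((diff_coord x 0).fun_mul d0) ((diff_coord x 1).fun_mul d1),
    pd_mul (diff_coord x 0) d0, pd_mul (diff_coord x 1) d1, pd_coord, pd_coord,
    pd_comm (smoothAt_pd hux i) 0 i, pd_comm (smoothAt_pd hux i) 1 i]
  fin_cases i <;> simp <;> ring

lemma lap_wf {τ : ℝ} (hτ : 0 < τ) {u : Pl → ℝ}
    (hsm : ContDiffOn ℝ (⊤ : ℕ∞) u {(0:Pl)}ᶜ)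
    (hpde : ∀ x : Pl, x ≠ 0 → lap u x + fτ τ (u x) = 0) {x : Pl} (hx : x ≠ 0) :
    lap (wf u) x = - fτ' τ (u x) * wf u x - 2 * fτ τ (u x) := by
  have hev := smooth_ev isOpen_compl_singleton hsm (x := x) hx
  have hux := hev.self_of_nhds
  have e : lap u =ᶠ[𝓝 x] fun y => - fτ τ (u y) := by
    filter_upwards [isOpen_compl_singleton.mem_nhds (show x ∈ ({(0:Pl)}ᶜ : Set Pl) from hx)] with y hy
    linarith [hpde y hy]
  have h2 : ∀ j, pd (pd (pd u 0) 0) j x + pd (pd (pd u 1) 1) j x = - (fτ' τ (u x) * pd u j x) := by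
    intro j
    rw [← pd_add (smoothAt_pd2 hux 0 0) (smoothAt_pd2 hux 1 1)]
    rw [show (fun y => pd (pd u 0) 0 y + pd (pd u 1) 1 y) = lap u from rfl, pd_congr e,
      pd_neg (u := fun y => fτ τ (u y)), pd_comp (smoothAt_diff hux) (hasDerivAt_fτ τ hτ _)]
    exact (hasDerivAt_fτ τ hτ _).differentiableAt.comp x (smoothAt_diff hux)
  have h3 := hpde x hx
  unfold lap at h3 ⊢
  rw [pd_pd_wf hev, pd_pd_wf hev]
  have a0 := h2 0
  have a1 := h2 1
  unfold wf
  linear_combination x 0 * a0 + x 1 * a1 + 2 * h3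

/-! ### The quadratic form -/

lemma smooth_diff {u : Pl → ℝ} (hu : ContDiff ℝ (⊤ : ℕ∞) u) (x : Pl) : DifferentiableAt ℝ u x :=
  smoothAt_diff hu.contDiffAt

lemma continuous_gradSq {φ : Pl → ℝ} (hφ : ContDiff ℝ (⊤ : ℕ∞) φ) : Continuous (gradSq φ) :=
  ((smooth_pd hφ 0).continuous.pow 2).add ((smooth_pd hφ 1).continuous.pow 2)

lemma pd_zero_of_notMem {φ : Pl → ℝ} {x : Pl} (hx : x ∉ tsupport φ) (i : Fin 2) :
    pd φ i x = 0 := by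
  rw [pd_congr (v := fun _ => 0) (notMem_tsupport_iff_eventuallyEq.1 hx), pd_const]

lemma gradSq_zero_of_notMem {φ : Pl → ℝ} {x : Pl} (hx : x ∉ tsupport φ) : gradSq φ x = 0 := by
  simp [gradSq, pd_zero_of_notMem hx]

lemma hcs_gradSq {φ : Pl → ℝ} (hc : HasCompactSupport φ) : HasCompactSupport (gradSq φ) :=
  HasCompactSupport.intro hc fun _ hx => gradSq_zero_of_notMem hx

lemma hcs_pd {φ : Pl → ℝ} (hc : HasCompactSupport φ) (i : Fin 2) : HasCompactSupport (pd φ i) :=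
  HasCompactSupport.intro hc fun _ hx => pd_zero_of_notMem hx i

lemma gradSq_nonneg (φ : Pl → ℝ) (x : Pl) : 0 ≤ gradSq φ x := by unfold gradSq; positivity

lemma normalise {φ c : Pl → ℝ} (hφ : ContDiff ℝ (⊤ : ℕ∞) φ) (hc : HasCompactSupport φ)
    (hs : tsupport φ ⊆ {(0:Pl)}ᶜ) (hQ : ∫ x, (gradSq φ x - c x * φ x ^ 2) < 0) :
    ∃ φ : Pl → ℝ, ContDiff ℝ (⊤ : ℕ∞) φ ∧ HasCompactSupport φ ∧
      tsupport φ ⊆ {(0:Pl)}ᶜ ∧ (∫ x : Pl, (φ x) ^ 2) = 1 ∧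
      (∫ x : Pl, (gradSq φ x - c x * (φ x) ^ 2)) < 0 := by
  have h0 : 0 ≤ ∫ x, φ x ^ 2 := integral_nonneg fun x => sq_nonneg _
  have hne : ∫ x, φ x ^ 2 ≠ 0 := by
    intro h
    have hintegr : Integrable (fun x => φ x ^ 2) := by
      refine Continuous.integrable_of_hasCompactSupport (hφ.continuous.pow 2) ?_
      exact hc.comp_left (g := fun t : ℝ => t ^ 2) (by simp)
    rw [integral_eq_zero_iff_of_nonneg (fun x => sq_nonneg _) hintegr] at h
    have h1 : (fun x => φ x ^ 2) = fun _ => 0 :=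
      (Continuous.ae_eq_iff_eq volume (hφ.continuous.pow 2) continuous_const).1 h
    have h2 : φ = fun _ => 0 := by
      funext x; simpa using congrFun h1 x
    rw [h2] at hQ
    simp [gradSq, pd_const] at hQ
  set I := ∫ x, φ x ^ 2 with hI
  have hIp : 0 < I := lt_of_le_of_ne h0 hne.symm
  set k := (√I)⁻¹ with hk
  have hk2 : k ^ 2 = I⁻¹ := by rw [hk, inv_pow, Real.sq_sqrt h0]
  have hg : ∀ x, gradSq (fun y => k * φ y) x = k ^ 2 * gradSq φ x := by
    intro x
    have : ∀ i, pd (fun y => k * φ y) i x = k * pd φ i x := by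
      intro i
      rw [pd_mul (u := fun _ => k) (differentiableAt_const k) (smooth_diff hφ x), pd_const]; ring
    simp only [gradSq, this]; ring
  refine ⟨fun y => k * φ y, contDiff_const.mul hφ, hc.mul_left, ?_, ?_, ?_⟩
  · exact (tsupport_mul_subset_right (f := fun _ => k) (g := φ)).trans hs
  · simp only [mul_pow, integral_const_mul, hk2, ← hI]
    exact inv_mul_cancel₀ hne
  · have : ∀ x, gradSq (fun y => k * φ y) x - c x * (k * φ x) ^ 2 =
        k ^ 2 * (gradSq φ x - c x * φ x ^ 2) := by intro x; rw [hg]; ring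
    simp only [this, integral_const_mul, hk2]
    exact mul_neg_of_pos_of_neg (inv_pos.2 hIp) hQ

/-- Integration by parts in the quadratic form. -/
lemma quad_le {η v c B : Pl → ℝ} (hη : ContDiff ℝ (⊤ : ℕ∞) η) (hc : HasCompactSupport η)
    (hv : ContDiff ℝ (⊤ : ℕ∞) v)
    (hL : Integrable fun x => c x * (η x * v x) ^ 2) (hB : Integrable B)
    (hle : ∀ x, gradSq η x * v x ^ 2 - η x ^ 2 * (v x * (lap v x + c x * v x)) ≤ B x) :
    ∫ x, (gradSq (fun y => η y * v y) x - c x * (η x * v x) ^ 2) ≤ ∫ x, B x := by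
  have hφ : ContDiff ℝ (⊤ : ℕ∞) (fun y => η y * v y) := hη.mul hv
  have hφc : HasCompactSupport (fun y => η y * v y) := hc.mul_right
  have i1 : Integrable (gradSq fun y => η y * v y) :=
    (continuous_gradSq hφ).integrable_of_hasCompactSupport (hcs_gradSq hφc)
  set X : Fin 2 → Pl → ℝ := fun i y => (η y ^ 2 * v y) * pd v i y with hX
  have hXs : ∀ i, ContDiff ℝ (⊤ : ℕ∞) (X i) := fun i => ((hη.pow 2).mul hv).mul (smooth_pd hv i)
  have hη2 : HasCompactSupport (fun y => η y ^ 2) := hc.comp_left (g := fun t : ℝ => t ^ 2) (by simp)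
  have hXc : ∀ i, HasCompactSupport (X i) := fun i =>
    (hη2.mul_right (f' := v)).mul_right (f' := pd v i)
  have i2 : ∀ i, Integrable (pd (X i) i) := fun i =>
    (smooth_pd (hXs i) i).continuous.integrable_of_hasCompactSupport (hcs_pd (hXc i) i)
  have z : ∀ i, ∫ x, pd (X i) i x = 0 := fun i =>
    integral_pd_eq_zero ((hXs i).of_le (by exact_mod_cast le_top)) (hXc i) i
  have e : ∀ x, gradSq (fun y => η y * v y) x - c x * (η x * v x) ^ 2
      - (pd (X 0) 0 x + pd (X 1) 1 x) =
      gradSq η x * v x ^ 2 - η x ^ 2 * (v x * (lap v x + c x * v x)) := by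
    intro x
    have dη := smooth_diff hη x
    have dv := smooth_diff hv x
    have p1 : ∀ i, pd (X i) i x = (2 * η x * pd η i x * v x + η x ^ 2 * pd v i x) * pd v i x +
        (η x ^ 2 * v x) * pd (pd v i) i x := by
      intro i
      rw [hX]
      simp only
      rw [pd_mul ((dη.fun_pow 2).fun_mul dv) (smooth_diff (smooth_pd hv i) x),
        pd_mul (dη.fun_pow 2) dv, pd_comp (g := fun t => t ^ 2) dη (hasDerivAt_pow 2 _)]
      simp
    simp only [gradSq, lap, p1, pd_mul dη dv]
    ring
  have i3 : Integrable fun x => gradSq (fun y => η y * v y) x - c x * (η x * v x) ^ 2 := i1.sub hL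
  have i4 : Integrable fun x => pd (X 0) 0 x + pd (X 1) 1 x := (i2 0).add (i2 1)
  calc ∫ x, (gradSq (fun y => η y * v y) x - c x * (η x * v x) ^ 2)
      = ∫ x, ((gradSq (fun y => η y * v y) x - c x * (η x * v x) ^ 2)
          - (pd (X 0) 0 x + pd (X 1) 1 x)) := by
        rw [integral_sub i3 i4, integral_add (i2 0) (i2 1), z, z]; simp
    _ ≤ ∫ x, B x := by
        refine integral_mono (i3.sub i4) hB fun x => ?_
        have := e x
        simp only
        rw [this]; exact hle x

/-- Pointwise bound for the linearized operator applied to `G(-w-κ)`. -/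
lemma pointwise_bound {τ : ℝ} (hτ : 0 < τ) {u : Pl → ℝ}
    (hsm : ContDiffOn ℝ (⊤ : ℕ∞) u {(0:Pl)}ᶜ)
    (hpde : ∀ x : Pl, x ≠ 0 → lap u x + fτ τ (u x) = 0)
    (hle : ∀ x : Pl, x ≠ 0 → u x ≤ 0) {δ κ : ℝ} {G : ℝ → ℝ}
    (hG : ContDiff ℝ (⊤ : ℕ∞) G)
    (hG2 : ∀ s, 0 ≤ G s ∧ G s ≤ max s 0 ∧ 0 ≤ deriv G s ∧ deriv G s ≤ 1 ∧ 0 ≤ s * deriv G s - G s ∧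
      s * deriv G s - G s ≤ δ * deriv G s ∧ 0 ≤ deriv (deriv G) s) (hδ : 0 ≤ δ) (hκ : 0 ≤ κ)
    {x : Pl} (hx : x ≠ 0) :
    -(G (-wf u x - κ) * (lap (fun y => G (-wf u y - κ)) x + fτ' τ (u x) * G (-wf u x - κ))) ≤
      - 2 * (fτ τ (u x) * (G (-wf u x - κ) * deriv G (-wf u x - κ))) +
        (3 * τ + 3) / τ ^ 4 * (δ + κ) * |wf u x| := by
  have hev := smooth_ev isOpen_compl_singleton hsm (x := x) hx
  have hux := hev.self_of_nhds
  have hG' : ∀ s, HasDerivAt G (deriv G s) s := fun s =>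
    (hG.differentiable (by simp) s).hasDerivAt
  have hG1 : ContDiff ℝ (⊤ : ℕ∞) (deriv G) := hG.deriv'
  have hG'' : ∀ s, HasDerivAt (deriv G) (deriv (deriv G) s) s := fun s =>
    (hG1.differentiable (by simp) s).hasDerivAt
  have dw : ∀ {y}, ContDiffAt ℝ (⊤ : ℕ∞) u y → DifferentiableAt ℝ (fun y => -wf u y - κ) y :=
    fun h => (smoothAt_diff (smoothAt_wf h)).fun_neg.sub_const κ
  have pw : ∀ {y}, ContDiffAt ℝ (⊤ : ℕ∞) u y → ∀ i, pd (fun y => -wf u y - κ) i y = - pd (wf u) i y := by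
    intro y h i
    have d := smoothAt_diff (smoothAt_wf h)
    have := pd_add (u := fun y => - wf u y) (v := fun _ => -κ) d.fun_neg (differentiableAt_const _) i
    simp only [← sub_eq_add_neg] at this
    rw [this, pd_neg d, pd_const]; ring
  have pv : ∀ i, pd (fun y => G (-wf u y - κ)) i =ᶠ[𝓝 x]
      fun y => deriv G (-wf u y - κ) * (- pd (wf u) i y) := by
    intro i
    filter_upwards [hev] with y hy
    rw [pd_comp (dw hy) (hG' _), pw hy]
  have pvv : ∀ i, pd (pd (fun y => G (-wf u y - κ)) i) i x =
      deriv (deriv G) (-wf u x - κ) * (pd (wf u) i x) ^ 2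
        - deriv G (-wf u x - κ) * pd (pd (wf u) i) i x := by
    intro i
    have d2 : DifferentiableAt ℝ (pd (wf u) i) x := smoothAt_diff (smoothAt_pd (smoothAt_wf hux) i)
    rw [pd_congr (pv i), pd_mul (u := fun y => deriv G (-wf u y - κ)) _ d2.fun_neg,
      pd_comp (dw hux) (hG'' _), pw hux, pd_neg d2]
    · ring
    · exact (hG'' _).differentiableAt.comp x (dw hux)
  have hl : lap (fun y => G (-wf u y - κ)) x = deriv (deriv G) (-wf u x - κ) * gradSq (wf u) x
      - deriv G (-wf u x - κ) * (- fτ' τ (u x) * wf u x - 2 * fτ τ (u x)) := by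
    rw [← lap_wf hτ hsm hpde hx]
    unfold lap gradSq
    rw [pvv, pvv]; ring
  rw [hl]
  have hf' := fτ'_bound hτ (hle x hx)
  have hg := gradSq_nonneg (wf u) x
  obtain ⟨g0, g1, g2, g3, g4, g5, g6⟩ := hG2 (-wf u x - κ)
  have hGw : G (-wf u x - κ) ≤ |wf u x| :=
    g1.trans (max_le (by linarith [neg_abs_le (wf u x)]) (abs_nonneg _))
  generalize hs : -wf u x - κ = s at *
  have hw : wf u x = - s - κ := by linarith
  set g := G s
  set g' := deriv G s
  set g'' := deriv (deriv G) s
  set f := fτ τ (u x)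
  set f' := fτ' τ (u x)
  set M := (3 * τ + 3) / τ ^ 4
  have hM : 0 ≤ M := (abs_nonneg _).trans hf'
  have t1 : 0 ≤ g * (g'' * gradSq (wf u) x) := by positivity
  have t2 : 0 ≤ (s * g' - g) + κ * g' := by positivity
  have t3 : (s * g' - g) + κ * g' ≤ δ + κ := by nlinarith
  have t4 : f' * (g * ((s * g' - g) + κ * g')) ≤ M * (|wf u x| * (δ + κ)) := by
    calc f' * (g * ((s * g' - g) + κ * g')) ≤ |f'| * (g * ((s * g' - g) + κ * g')) := by
          gcongr; exact le_abs_self _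
      _ ≤ M * (|wf u x| * (δ + κ)) := by gcongr
  have t5 : -(g * (g'' * gradSq (wf u) x - g' * (-f' * wf u x - 2 * f) + f' * g)) =
      - (g * (g'' * gradSq (wf u) x)) - 2 * (f * (g * g')) + f' * (g * ((s * g' - g) + κ * g')) := by
    rw [hw]; ring
  rw [t5]
  linarith

/-! ### Logarithm, maximum principle -/

lemma normSq_eq (x : Pl) : ‖x‖ ^ 2 = x 0 ^ 2 + x 1 ^ 2 := by
  rw [EuclideanSpace.real_norm_sq_eq]; simp

lemma smoothAt_log {x : Pl} (hx : x ≠ 0) : ContDiffAt ℝ (⊤ : ℕ∞) (fun y : Pl => Real.log ‖y‖) x :=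
  (contDiffAt_norm ℝ hx).log (norm_ne_zero_iff.2 hx)

lemma log_norm_eq : (fun y : Pl => Real.log ‖y‖) = fun y => 2⁻¹ * Real.log (y 0 ^ 2 + y 1 ^ 2) := by
  funext y
  rw [← normSq_eq, Real.log_pow]; push_cast; ring

lemma pd_sumsq (x : Pl) (i : Fin 2) : pd (fun y : Pl => y 0 ^ 2 + y 1 ^ 2) i x = 2 * x i := by
  have d0 := diff_coord x 0
  have d1 := diff_coord x 1
  rw [pd_add (d0.fun_pow 2) (d1.fun_pow 2), pd_comp (g := fun t => t ^ 2) d0 (hasDerivAt_pow 2 _),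
    pd_comp (g := fun t => t ^ 2) d1 (hasDerivAt_pow 2 _), pd_coord, pd_coord]
  fin_cases i <;> simp

lemma diff_sumsq (x : Pl) : DifferentiableAt ℝ (fun y : Pl => y 0 ^ 2 + y 1 ^ 2) x :=
  ((diff_coord x 0).fun_pow 2).fun_add ((diff_coord x 1).fun_pow 2)

lemma sumsq_ne {x : Pl} (hx : x ≠ 0) : x 0 ^ 2 + x 1 ^ 2 ≠ 0 := by
  rw [← normSq_eq]; exact pow_ne_zero 2 (norm_ne_zero_iff.2 hx)

lemma pd_log {x : Pl} (hx : x ≠ 0) (i : Fin 2) :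
    pd (fun y : Pl => Real.log ‖y‖) i x = x i / (x 0 ^ 2 + x 1 ^ 2) := by
  have h := sumsq_ne hx
  rw [log_norm_eq, pd_mul (u := fun _ => (2:ℝ)⁻¹) (differentiableAt_const _) ((diff_sumsq x).log h),
    pd_const, pd_comp (diff_sumsq x) (Real.hasDerivAt_log h), pd_sumsq]
  field_simp; ring

lemma lap_log {x : Pl} (hx : x ≠ 0) : lap (fun y : Pl => Real.log ‖y‖) x = 0 := by
  have h := sumsq_ne hx
  have e : ∀ i, pd (fun y : Pl => Real.log ‖y‖) i =ᶠ[𝓝 x]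
      fun y => y i * (y 0 ^ 2 + y 1 ^ 2)⁻¹ := by
    intro i
    filter_upwards [isOpen_compl_singleton.mem_nhds (show x ∈ ({(0:Pl)}ᶜ : Set Pl) from hx)] with y hy
    rw [pd_log hy]; rfl
  have p : ∀ i, pd (pd (fun y : Pl => Real.log ‖y‖) i) i x =
      (x 0 ^ 2 + x 1 ^ 2)⁻¹ - 2 * x i ^ 2 * ((x 0 ^ 2 + x 1 ^ 2)^2)⁻¹ := by
    intro i
    rw [pd_congr (e i), pd_mul (diff_coord x i) ((diff_sumsq x).fun_inv h), pd_coord,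
      pd_comp (diff_sumsq x) (hasDerivAt_inv h), pd_sumsq]
    simp; ring
  unfold lap
  rw [p, p]
  field_simp; ring

lemma pd_pd_le_of_localMax {g : Pl → ℝ} {x : Pl} (hc : ContinuousAt g x) (h : IsLocalMax g x)
    (i : Fin 2) : pd (pd g i) i x ≤ 0 := by
  set e : Pl := EuclideanSpace.single i (1:ℝ)
  set k : ℝ → ℝ := fun t => g (x + t • e) with hk
  have hline : Continuous fun t : ℝ => x + t • e := by fun_prop
  have h1 : ∀ t, deriv k t = pd g i (x + t • e) := by
    intro t
    have := deriv_comp_add_const k t 0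
    rw [zero_add] at this
    rw [← this]
    unfold pd lineDeriv
    congr 1
    funext s
    simp only [hk]; congr 1; rw [add_smul]; abel
  have h2 : deriv (deriv k) 0 = pd (pd g i) i x := by
    rw [show deriv k = fun t => pd g i (x + t • e) from funext h1]; rfl
  have ht : Tendsto (fun t : ℝ => x + t • e) (𝓝 0) (𝓝 x) := by
    have := hline.tendsto 0; simpa using this
  have kmax : IsLocalMax k 0 := by
    have := ht.eventually h
    filter_upwards [this] with t ht'
    simpa [hk] using ht'
  rw [← h2]
  by_contra hcon
  push Not at hcon
  have kc : ContinuousAt k 0 := by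
    have : Tendsto k (𝓝 0) (𝓝 (g x)) := hc.tendsto.comp ht
    simpa [ContinuousAt, hk] using this
  have kmin := isLocalMin_of_deriv_deriv_pos hcon kmax.deriv_eq_zero kc
  have kconst : k =ᶠ[𝓝 0] fun _ => k 0 := by
    filter_upwards [kmax, kmin] with t a b using le_antisymm a b
  have : deriv (deriv k) 0 = 0 := by
    rw [kconst.deriv.deriv_eq]; simp
  linarith

lemma log_near_zero (C : ℝ) : ∀ᶠ x : Pl in 𝓝[≠] 0, Real.log ‖x‖ < C := by
  have h1 : Tendsto (fun x : Pl => ‖x‖) (𝓝[≠] 0) (𝓝[>] 0) := tendsto_norm_nhdsNE_zero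
  exact (Real.tendsto_log_nhdsGT_zero.comp h1).eventually_lt_atBot C

lemma sing_bdd {u : Pl → ℝ} {ν : ℝ} (hν : 0 ≤ ν) (hsing : LogSing u 0 ν) :
    ∃ C, ∀ᶠ x : Pl in 𝓝[≠] 0, u x ≤ C := by
  obtain ⟨r, hr, v, hv, huv⟩ := hsing
  have hvc : ContinuousAt v 0 := hv.continuousOn.continuousAt (ball_mem_nhds 0 hr)
  refine ⟨v 0 + 1, ?_⟩
  have h1 : ∀ᶠ x in 𝓝[≠] (0:Pl), v x < v 0 + 1 :=
    (hvc.eventually (gt_mem_nhds (by linarith))).filter_mono nhdsWithin_le_nhds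
  have h2 : ∀ᶠ x in 𝓝[≠] (0:Pl), x ∈ ball (0:Pl) r :=
    nhdsWithin_le_nhds (ball_mem_nhds 0 hr)
  filter_upwards [h1, h2, log_near_zero 0, self_mem_nhdsWithin] with x a b c d
  rw [huv x b d, sub_zero]
  nlinarith [mul_nonneg hν (neg_nonneg.2 c.le)]

lemma eventually_far {u : Pl → ℝ} (hinf : Tendsto u (cocompact Pl) atBot) (C : ℝ) :
    ∃ R > 1, ∀ x : Pl, R ≤ ‖x‖ → u x < C := by
  have h := hinf.eventually_lt_atBot C
  rw [← Metric.cobounded_eq_cocompact, ← comap_norm_atTop] at h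
  obtain ⟨t, ht, hs⟩ := h
  obtain ⟨R, hR⟩ := mem_atTop_sets.1 ht
  exact ⟨max R 2, lt_of_lt_of_le (by norm_num) (le_max_right _ _), fun x hx => hs (hR _ ((le_max_left _ _).trans hx))⟩

lemma u_nonpos {τ : ℝ} (hτ : 0 < τ) {ν : ℝ} (hν : 0 ≤ ν) {u : Pl → ℝ}
    (hsm : ContDiffOn ℝ (⊤ : ℕ∞) u {(0:Pl)}ᶜ)
    (hsing : LogSing u 0 ν)
    (hpde : ∀ x : Pl, x ≠ 0 → lap u x + fτ τ (u x) = 0)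
    (hinf : Tendsto u (cocompact Pl) atBot) : ∀ x : Pl, x ≠ 0 → u x ≤ 0 := by
  intro x₁ hx₁
  by_contra hpos
  push Not at hpos
  obtain ⟨R, hR1, hR⟩ := eventually_far hinf 0
  have hx1R : ‖x₁‖ < R := by
    by_contra h
    exact absurd (hR x₁ (not_lt.1 h)) (not_lt.2 hpos.le)
  have hn1 : 0 < ‖x₁‖ := norm_pos_iff.2 hx₁
  have hlog : 0 < Real.log R - Real.log ‖x₁‖ := sub_pos.2 (Real.log_lt_log hn1 hx1R)
  obtain ⟨ε, hε, hε2⟩ : ∃ ε > 0, ε * (Real.log R - Real.log ‖x₁‖) < u x₁ := by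
    refine ⟨u x₁ / (2 * (Real.log R - Real.log ‖x₁‖)), by positivity, ?_⟩
    rw [div_mul_eq_mul_div, div_lt_iff₀ (by positivity)]
    nlinarith [mul_pos hpos hlog]
  set g : Pl → ℝ := fun x => u x + ε * (Real.log ‖x‖ + - Real.log R) with hg
  have hg1 : 0 < g x₁ := by simp only [hg]; linarith
  obtain ⟨C, hC⟩ := sing_bdd hν hsing
  have hnear : ∀ᶠ x : Pl in 𝓝[≠] 0, g x < 0 := by
    filter_upwards [hC, log_near_zero (Real.log R - (|C| + 1) / ε)] with x a b
    have : ε * (Real.log ‖x‖ + - Real.log R) < ε * (- ((|C| + 1) / ε)) := by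
      apply mul_lt_mul_of_pos_left _ hε; linarith
    have h3 : ε * (- ((|C| + 1) / ε)) = - (|C| + 1) := by field_simp
    simp only [hg]
    linarith [le_abs_self C]
  rw [eventually_nhdsWithin_iff, Metric.eventually_nhds_iff] at hnear
  obtain ⟨r, hr, hnear⟩ := hnear
  have gs : ∀ x, x ≠ 0 → ContDiffAt ℝ (⊤ : ℕ∞) g x := fun x hx =>
    (smoothAt_ev hsm hx).add (contDiffAt_const.mul ((smoothAt_log hx).add contDiffAt_const))
  set K : Set Pl := {x | r / 2 ≤ ‖x‖ ∧ ‖x‖ ≤ R} with hK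
  have hKc : IsCompact K := by
    apply (isCompact_closedBall (0:Pl) R).of_isClosed_subset
    · exact (isClosed_le continuous_const continuous_norm).inter
        (isClosed_le continuous_norm continuous_const)
    · intro x hx; simpa using hx.2
  have hK0 : ∀ x ∈ K, x ≠ 0 := by
    intro x hx h
    have := hx.1
    rw [h, norm_zero] at this; linarith
  have hx1K : x₁ ∈ K := by
    refine ⟨?_, hx1R.le⟩
    by_contra h
    have := hnear (y := x₁) (by simp; linarith) hx₁
    linarith
  obtain ⟨x₂, hx2, hmax⟩ := hKc.exists_isMaxOn ⟨x₁, hx1K⟩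
    (fun x hx => (gs x (hK0 x hx)).continuousAt.continuousWithinAt)
  have hx20 := hK0 x₂ hx2
  have hg2 : 0 < g x₂ := hg1.trans_le (hmax hx1K)
  have a1 : r / 2 < ‖x₂‖ := by
    by_contra h
    have := hnear (y := x₂) (by simp; linarith) hx20
    linarith
  have a2 : ‖x₂‖ < R := by
    rcases hx2.2.lt_or_eq with h | h
    · exact h
    · exfalso
      have := hR x₂ h.ge
      simp only [hg, h] at hg2
      linarith
  have hloc : IsLocalMax g x₂ := by
    apply hmax.isLocalMax
    have o1 : {x : Pl | r / 2 < ‖x‖} ∈ 𝓝 x₂ := (isOpen_lt continuous_const continuous_norm).mem_nhds a1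
    have o2 : {x : Pl | ‖x‖ < R} ∈ 𝓝 x₂ := (isOpen_lt continuous_norm continuous_const).mem_nhds a2
    filter_upwards [o1, o2] with x b c using ⟨le_of_lt b, le_of_lt c⟩
  have l0 := pd_pd_le_of_localMax (gs x₂ hx20).continuousAt hloc 0
  have l1 := pd_pd_le_of_localMax (gs x₂ hx20).continuousAt hloc 1
  have hlap : lap g x₂ = lap u x₂ := by
    have e : ∀ i, pd g i =ᶠ[𝓝 x₂] fun y => pd u i y + ε * pd (fun y : Pl => Real.log ‖y‖) i y := by
      intro i
      filter_upwards [isOpen_compl_singleton.mem_nhds (show x₂ ∈ ({(0:Pl)}ᶜ : Set Pl) from hx20)]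
        with y hy
      have dl := smoothAt_diff (smoothAt_log hy)
      have d2 := dl.fun_add (differentiableAt_const (- Real.log R))
      simp only [hg]
      rw [pd_add (smoothAt_diff (smoothAt_ev hsm hy)) ((differentiableAt_const ε).fun_mul d2),
        pd_mul (u := fun _ => ε) (differentiableAt_const ε) d2, pd_add dl (differentiableAt_const _),
        pd_const, pd_const]
      ring
    have ll := lap_log hx20
    unfold lap at ll ⊢
    have p : ∀ i, pd (pd g i) i x₂ = pd (pd u i) i x₂ +
        ε * pd (pd (fun y : Pl => Real.log ‖y‖) i) i x₂ := by
      intro i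
      have du := smoothAt_diff (smoothAt_pd (smoothAt_ev hsm hx20) i)
      have dl := smoothAt_diff (smoothAt_pd (smoothAt_log hx20) i)
      rw [pd_congr (e i), pd_add du ((differentiableAt_const ε).fun_mul dl),
        pd_mul (u := fun _ => ε) (differentiableAt_const ε) dl, pd_const]
      ring
    rw [p, p]
    linear_combination ε * ll
  have hu2 : 0 < u x₂ := by
    have : Real.log ‖x₂‖ ≤ Real.log R := Real.log_le_log (norm_pos_iff.2 hx20) a2.le
    have h3 : ε * (Real.log ‖x₂‖ + - Real.log R) ≤ 0 :=
      mul_nonpos_of_nonneg_of_nonpos hε.le (by linarith)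
    simp only [hg] at hg2; linarith
  have := fτ_neg hτ hu2
  have h4 := hpde x₂ hx20
  have h5 : lap g x₂ ≤ 0 := by unfold lap; linarith
  linarith

/-! ### Behaviour of `w = x · ∇u` -/

lemma wf_zero (u : Pl → ℝ) : wf u 0 = 0 := by simp [wf]

lemma wf_near {u : Pl → ℝ} {ν : ℝ} (hsing : LogSing u 0 ν) {κ : ℝ} (hκ : 0 < κ) :
    ∀ᶠ x : Pl in 𝓝[≠] 0, |wf u x - 2 * ν| < κ := by
  obtain ⟨r, hr, v, hv, huv⟩ := hsing
  have hvs : ContDiffAt ℝ (⊤ : ℕ∞) v 0 := hv.contDiffAt (ball_mem_nhds 0 hr)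
  have hwc : ContinuousAt (wf v) 0 := (smoothAt_wf hvs).continuousAt
  have h1 : ∀ᶠ x in 𝓝[≠] (0:Pl), |wf v x| < κ := by
    have : Tendsto (fun x => |wf v x|) (𝓝 0) (𝓝 |wf v 0|) := hwc.abs
    rw [wf_zero, abs_zero] at this
    exact (this.eventually (gt_mem_nhds hκ)).filter_mono nhdsWithin_le_nhds
  have h2 : ∀ᶠ x in 𝓝[≠] (0:Pl), x ∈ ball (0:Pl) r :=
    nhdsWithin_le_nhds (ball_mem_nhds 0 hr)
  filter_upwards [h1, h2, self_mem_nhdsWithin] with x a b c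
  have c' : x ≠ 0 := c
  have hvx : ContDiffAt ℝ (⊤ : ℕ∞) v x := hv.contDiffAt (isOpen_ball.mem_nhds b)
  have e : u =ᶠ[𝓝 x] fun y => (2 * ν) * Real.log ‖y‖ + v y := by
    filter_upwards [isOpen_ball.mem_nhds b, isOpen_compl_singleton.mem_nhds c] with y hy hy0
    rw [huv y hy hy0, sub_zero]
  have p : ∀ i, pd u i x = 2 * ν * (x i / (x 0 ^ 2 + x 1 ^ 2)) + pd v i x := by
    intro i
    have dl := smoothAt_diff (smoothAt_log c')
    rw [pd_congr e, pd_add ((differentiableAt_const (2 * ν)).fun_mul dl) (smoothAt_diff hvx),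
      pd_mul (u := fun _ => 2 * ν) (differentiableAt_const _) dl, pd_const, pd_log c']
    ring
  have : wf u x - 2 * ν = wf v x := by
    have h := sumsq_ne c'
    unfold wf
    rw [p, p]; field_simp; ring
  rw [this]; exact a

lemma wf_bdd {u : Pl → ℝ} {ν : ℝ} (hsm : ContDiffOn ℝ (⊤ : ℕ∞) u {(0:Pl)}ᶜ)
    (hsing : LogSing u 0 ν) (R : ℝ) : ∃ W, ∀ x : Pl, ‖x‖ ≤ R → |wf u x| ≤ W := by
  have h := wf_near hsing one_pos
  rw [eventually_nhdsWithin_iff, Metric.eventually_nhds_iff] at h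
  obtain ⟨r, hr, h⟩ := h
  set K : Set Pl := {x | r / 2 ≤ ‖x‖ ∧ ‖x‖ ≤ R} with hK
  have hKc : IsCompact K := by
    apply (isCompact_closedBall (0:Pl) R).of_isClosed_subset
    · exact (isClosed_le continuous_const continuous_norm).inter
        (isClosed_le continuous_norm continuous_const)
    · intro x hx; simpa using hx.2
  have hK0 : ∀ x ∈ K, x ≠ 0 := by
    intro x hx h
    have := hx.1
    rw [h, norm_zero] at this; linarith
  obtain ⟨C, hC⟩ := hKc.exists_bound_of_continuousOn (f := wf u)
    (fun x hx => (smoothAt_wf (smoothAt_ev hsm (hK0 x hx))).continuousAt.continuousWithinAt)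
  refine ⟨max C (2 * |ν| + 1), fun x hx => ?_⟩
  by_cases h0 : x = 0
  · rw [h0, wf_zero, abs_zero]; exact le_max_of_le_right (by positivity)
  by_cases hx2 : r / 2 ≤ ‖x‖
  · exact le_max_of_le_left (hC x ⟨hx2, hx⟩)
  · apply le_max_of_le_right
    have := h (y := x) (by simp; linarith) h0
    have h3 : |wf u x| ≤ |wf u x - 2 * ν| + |2 * ν| := by
      have := abs_add_le (wf u x - 2 * ν) (2 * ν); simpa using this
    rw [abs_mul, abs_two] at h3
    linarith

lemma exists_neg_point {u : Pl → ℝ} (hsm : ContDiffOn ℝ (⊤ : ℕ∞) u {(0:Pl)}ᶜ)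
    (hinf : Tendsto u (cocompact Pl) atBot) : ∃ x : Pl, x ≠ 0 ∧ u x < 0 ∧ wf u x < 0 := by
  obtain ⟨R, hR1, hR⟩ := eventually_far hinf 0
  set e : Pl := EuclideanSpace.single 0 (1:ℝ) with he
  have hne : ‖e‖ = 1 := by simp [he]
  have hnt : ∀ t : ℝ, 0 < t → ‖t • e‖ = t := by
    intro t ht; rw [norm_smul, hne, mul_one, Real.norm_of_nonneg ht.le]
  obtain ⟨R', hR1', hR'⟩ := eventually_far hinf (u (R • e))
  set T := max (R + 1) R'
  have hT : R < T := lt_of_lt_of_le (by linarith) (le_max_left _ _)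
  have hT0 : 0 < T := by linarith
  have hlt : u (T • e) < u (R • e) := hR' _ (by rw [hnt T hT0]; exact le_max_right _ _)
  have hne0 : ∀ t : ℝ, R ≤ t → t • e ≠ 0 := by
    intro t ht h
    have := hnt t (by linarith); rw [h, norm_zero] at this; linarith
  have hd : ∀ t : ℝ, R ≤ t → HasDerivAt (fun t : ℝ => u (t • e)) (pd u 0 (t • e)) t := by
    intro t ht
    have du := smoothAt_diff (smoothAt_ev hsm (hne0 t ht))
    have h1 : HasDerivAt (fun t : ℝ => t • e) e t := by
      simpa using (hasDerivAt_id t).smul_const e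
    have := du.hasFDerivAt.comp_hasDerivAt t h1
    rw [pd_eq du]; exact this
  obtain ⟨c, hc, hcd⟩ := exists_hasDerivAt_eq_slope (fun t : ℝ => u (t • e))
    (fun t => pd u 0 (t • e)) hT
    (fun t ht => (hd t ht.1).continuousAt.continuousWithinAt) (fun t ht => hd t ht.1.le)
  have hc0 : 0 < c := by linarith [hc.1]
  refine ⟨c • e, hne0 c hc.1.le, hR _ (by rw [hnt c hc0]; exact hc.1.le), ?_⟩
  have hneg : pd u 0 (c • e) < 0 := by
    rw [hcd]; exact div_neg_of_neg_of_pos (by linarith) (by linarith)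
  have : wf u (c • e) = c * pd u 0 (c • e) := by simp [wf, he]
  rw [this]
  exact mul_neg_of_pos_of_neg hc0 hneg

/-- The composition `G(-w-κ)` is globally smooth and vanishes near the origin. -/
lemma smooth_v {u : Pl → ℝ} {ν : ℝ} (hν : 0 ≤ ν) (hsm : ContDiffOn ℝ (⊤ : ℕ∞) u {(0:Pl)}ᶜ)
    (hsing : LogSing u 0 ν) {κ : ℝ} (hκ : 0 < κ) {G : ℝ → ℝ} (hG : ContDiff ℝ (⊤ : ℕ∞) G)
    (hG0 : ∀ s ≤ 0, G s = 0) :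
    (fun x => G (-wf u x - κ)) =ᶠ[𝓝 0] (fun _ => 0) ∧
    ContDiff ℝ (⊤ : ℕ∞) (fun x => G (-wf u x - κ)) := by
  have h0 : (fun x => G (-wf u x - κ)) =ᶠ[𝓝 0] (fun _ => 0) := by
    have h := wf_near hsing hκ
    rw [eventually_nhdsWithin_iff] at h
    filter_upwards [h] with x hx
    apply hG0
    by_cases h0 : x = 0
    · rw [h0, wf_zero]; linarith
    · have := (abs_lt.1 (hx h0)).1
      linarith
  refine ⟨h0, contDiff_iff_contDiffAt.2 fun x => ?_⟩
  by_cases hx : x = 0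
  · rw [hx]; exact contDiffAt_const.congr_of_eventuallyEq h0
  · exact hG.contDiffAt.comp x ((smoothAt_wf (smoothAt_ev hsm hx)).neg.sub contDiffAt_const)

/-! ### Mean values over balls -/

/-- The kernel `ψ(z) = 4 (1-|z|²)₊`. -/
def psi (z : Pl) : ℝ := 4 * max 0 (1 - (z 0 ^ 2 + z 1 ^ 2))

/-- The kernel `P(z) = (1-|z|²)₊²`, with `∇P(z) = -ψ(z) z`. -/
def kerP (z : Pl) : ℝ := (max 0 (1 - (z 0 ^ 2 + z 1 ^ 2))) ^ 2

lemma hasDerivAt_maxsq (s : ℝ) : HasDerivAt (fun s : ℝ => (max 0 s) ^ 2) (2 * max 0 s) s := by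
  rcases lt_trichotomy s 0 with h | h | h
  · have : (fun s : ℝ => (max 0 s) ^ 2) =ᶠ[𝓝 s] fun _ => 0 := by
      filter_upwards [gt_mem_nhds h] with y hy
      simp [max_eq_left (le_of_lt hy)]
    rw [max_eq_left h.le, mul_zero]
    exact (hasDerivAt_const s (0:ℝ)).congr_of_eventuallyEq this
  · subst h
    rw [hasDerivAt_iff_isLittleO]
    simp only [max_self, ne_eq, OfNat.ofNat_ne_zero, not_false_eq_true, zero_pow, sub_zero, mul_zero,
      smul_zero]
    refine Asymptotics.IsBigO.trans_isLittleO (g := fun x : ℝ => x ^ 2) ?_ ?_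
    · refine Asymptotics.IsBigO.of_bound 1 (Eventually.of_forall fun x => ?_)
      rw [one_mul, Real.norm_of_nonneg (sq_nonneg _), Real.norm_of_nonneg (sq_nonneg _)]
      rcases le_total x 0 with h | h
      · rw [max_eq_left h]; simpa using sq_nonneg x
      · rw [max_eq_right h]
    · simpa using Asymptotics.isLittleO_pow_id (𝕜 := ℝ) (n := 2) (by norm_num)
  · have : (fun s : ℝ => (max 0 s) ^ 2) =ᶠ[𝓝 s] fun s => s ^ 2 := by
      filter_upwards [lt_mem_nhds h] with y hy
      simp [max_eq_right (le_of_lt hy)]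
    rw [max_eq_right h.le]
    have h2 := (hasDerivAt_pow 2 s).congr_of_eventuallyEq this
    simpa using h2

lemma contDiff_maxsq : ContDiff ℝ 1 (fun s : ℝ => (max 0 s) ^ 2) := by
  rw [contDiff_one_iff_deriv]
  refine ⟨fun s => (hasDerivAt_maxsq s).differentiableAt, ?_⟩
  rw [show deriv (fun s : ℝ => (max 0 s) ^ 2) = fun s => 2 * max 0 s from
    funext fun s => (hasDerivAt_maxsq s).deriv]
  fun_prop

lemma contDiff_sumsq {n : WithTop ℕ∞} : ContDiff ℝ n (fun z : Pl => 1 - (z 0 ^ 2 + z 1 ^ 2)) :=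
  contDiff_const.sub (((contDiff_coord 0).pow 2).add ((contDiff_coord 1).pow 2))

lemma contDiff_ker : ContDiff ℝ 1 kerP := contDiff_maxsq.comp contDiff_sumsq

lemma continuous_psi : Continuous psi :=
  continuous_const.mul (continuous_const.max (contDiff_sumsq (n := 0)).continuous)

lemma pd_ker (z : Pl) (i : Fin 2) : pd kerP i z = - psi z * z i := by
  unfold kerP
  have d : DifferentiableAt ℝ (fun z : Pl => 1 - (z 0 ^ 2 + z 1 ^ 2)) z :=
    (contDiff_sumsq (n := 1)).contDiffAt.differentiableAt (by simp)
  rw [pd_comp d (hasDerivAt_maxsq _)]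
  have h := pd_add (u := fun _ => (1:ℝ)) (v := fun z : Pl => - (z 0 ^ 2 + z 1 ^ 2))
    (differentiableAt_const 1) (diff_sumsq z).fun_neg i
  simp only [← sub_eq_add_neg] at h
  rw [h, pd_const, pd_neg (diff_sumsq z), pd_sumsq]
  unfold psi; ring

lemma psi_nonneg (z : Pl) : 0 ≤ psi z := by unfold psi; positivity
lemma ker_nonneg (z : Pl) : 0 ≤ kerP z := by unfold kerP; positivity

lemma psi_zero {z : Pl} (hz : 1 ≤ ‖z‖) : psi z = 0 := by
  have : 1 ≤ ‖z‖ ^ 2 := by nlinarith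
  rw [psi, ← normSq_eq, max_eq_left (by linarith), mul_zero]

lemma ker_zero {z : Pl} (hz : 1 ≤ ‖z‖) : kerP z = 0 := by
  have : 1 ≤ ‖z‖ ^ 2 := by nlinarith
  rw [kerP, ← normSq_eq, max_eq_left (by linarith)]; simp

lemma psi_le (z : Pl) : psi z ≤ 4 := by
  unfold psi
  have : max 0 (1 - (z 0 ^ 2 + z 1 ^ 2)) ≤ 1 := max_le (by norm_num) (by nlinarith)
  linarith

lemma ker_le (z : Pl) : kerP z ≤ 1 := by
  unfold kerP
  have : max 0 (1 - (z 0 ^ 2 + z 1 ^ 2)) ≤ 1 := max_le (by norm_num) (by nlinarith)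
  have h0 : 0 ≤ max 0 (1 - (z 0 ^ 2 + z 1 ^ 2)) := le_max_left _ _
  nlinarith

lemma psi_ge {z : Pl} (hz : ‖z‖ ≤ 1 / 2) : 3 ≤ psi z := by
  have : ‖z‖ ^ 2 ≤ 1 / 4 := by nlinarith [norm_nonneg z]
  rw [psi, ← normSq_eq]
  have := le_max_right 0 (1 - ‖z‖ ^ 2)
  linarith

lemma hcs_of_ball {F : Pl → ℝ} (h : ∀ z, 1 ≤ ‖z‖ → F z = 0) : HasCompactSupport F :=
  HasCompactSupport.intro (isCompact_closedBall (0:Pl) 1) fun z hz => h z (by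
    simp at hz; exact hz.le)

lemma hcs_psi : HasCompactSupport psi := hcs_of_ball fun _ => psi_zero
lemma hcs_ker : HasCompactSupport kerP := hcs_of_ball fun _ => ker_zero

lemma contDiff_affine {n : WithTop ℕ∞} (a : Pl) (t : ℝ) : ContDiff ℝ n (fun z : Pl => a + t • z) := by
  fun_prop

lemma pd_affine {F : Pl → ℝ} (hF : ContDiff ℝ (⊤ : ℕ∞) F) (a : Pl) (t : ℝ) (z : Pl) (i : Fin 2) :
    pd (fun z => F (a + t • z)) i z = t * pd F i (a + t • z) := by
  have d : HasFDerivAt (fun z : Pl => a + t • z) (t • ContinuousLinearMap.id ℝ Pl) z :=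
    ((hasFDerivAt_id z).const_smul t).const_add a
  have d2 := (smooth_diff hF (a + t • z)).hasFDerivAt.comp z d
  have d3 : HasFDerivAt (fun z => F (a + t • z)) _ z := d2
  rw [pd_eq d3.differentiableAt, d3.fderiv, pd_eq (smooth_diff hF _)]
  simp

/-- Averages of `H` over the ball `B(a,t)`. -/
def Phi (H : Pl → ℝ) (a : Pl) (t : ℝ) : ℝ := ∫ z, psi z * H (a + t • z)

lemma hasDerivAt_Phi {H : Pl → ℝ} (hH : ContDiff ℝ (⊤ : ℕ∞) H) (a : Pl) (t : ℝ) :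
    HasDerivAt (Phi H a) (t * ∫ z, kerP z * lap H (a + t • z)) t := by
  set k : ℝ → Pl → ℝ := fun t z => psi z * (z 0 * pd H 0 (a + t • z) + z 1 * pd H 1 (a + t • z)) with hk
  have c0 := (smooth_pd hH 0).continuous
  have c1 := (smooth_pd hH 1).continuous
  have cz0 := (contDiff_coord (n := 0) 0).continuous
  have cz1 := (contDiff_coord (n := 0) 1).continuous
  have hpsi := continuous_psi
  have hHc := hH.continuous
  have ca : ∀ s : ℝ, Continuous fun z : Pl => a + s • z := fun s =>
    (contDiff_affine (n := 0) a s).continuous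
  have kc : Continuous fun p : ℝ × Pl => k p.1 p.2 := by
    simp only [hk]; fun_prop
  obtain ⟨C, hC⟩ := ((isCompact_Icc (a := t - 1) (b := t + 1)).prod
    (isCompact_closedBall (0:Pl) 1)).exists_bound_of_continuousOn kc.continuousOn
  have hder : ∀ z s, HasDerivAt (fun s => psi z * H (a + s • z)) (k s z) s := by
    intro z s
    have h1 : HasDerivAt (fun s : ℝ => a + s • z) z s := by
      simpa using ((hasDerivAt_id s).smul_const z).const_add a
    have h2 := (smooth_diff hH (a + s • z)).hasFDerivAt.comp_hasDerivAt s h1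
    have h3 := h2.const_mul (psi z)
    have ez : z = z 0 • EuclideanSpace.single 0 (1:ℝ) + z 1 • EuclideanSpace.single 1 (1:ℝ) := by
      ext i; fin_cases i <;> simp
    have h4 : fderiv ℝ H (a + s • z) z = z 0 * pd H 0 (a + s • z) + z 1 * pd H 1 (a + s • z) := by
      rw [pd_eq (smooth_diff hH _), pd_eq (smooth_diff hH _)]
      conv_lhs => rw [ez, map_add, map_smul, map_smul]
      rw [← ez]
      simp
    rw [h4] at h3
    exact h3
  have hintegr : ∀ s, Integrable (fun z => psi z * H (a + s • z)) := fun s =>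
    Continuous.integrable_of_hasCompactSupport (hpsi.mul (hHc.comp (ca s)))
      (hcs_psi.mul_right (f' := fun z => H (a + s • z)))
  have key := hasDerivAt_integral_of_dominated_loc_of_deriv_le (μ := (volume : Measure Pl))
    (F := fun s z => psi z * H (a + s • z)) (F' := k) (x₀ := t) (s := Icc (t - 1) (t + 1))
    (bound := (closedBall (0:Pl) 1).indicator fun _ => C)
    (Icc_mem_nhds (by linarith) (by linarith))
    (Eventually.of_forall fun s => (hintegr s).aestronglyMeasurable)
    (hintegr t) (by
      have : Continuous (k t) := kc.comp (by fun_prop : Continuous fun z : Pl => (t, z))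
      exact this.aestronglyMeasurable)
    (Eventually.of_forall fun z s hs => by
      by_cases hz : z ∈ closedBall (0:Pl) 1
      · rw [indicator_of_mem hz]
        exact hC (s, z) ⟨hs, hz⟩
      · rw [indicator_of_notMem hz]
        have : 1 ≤ ‖z‖ := by simp at hz; exact hz.le
        simp [hk, psi_zero this])
    ((integrable_indicator_iff measurableSet_closedBall).2
      (integrableOn_const (isCompact_closedBall (0:Pl) 1).measure_lt_top.ne))
    (Eventually.of_forall fun z s _ => hder z s)
  have h2 := key.2
  have e : ∫ z, k t z = t * ∫ z, kerP z * lap H (a + t • z) := by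
    set X : Fin 2 → Pl → ℝ := fun i z => kerP z * pd H i (a + t • z) with hX
    have hXs : ∀ i, ContDiff ℝ 1 (X i) := fun i => contDiff_ker.mul
      (((smooth_pd hH i).of_le (by exact_mod_cast le_top)).comp (contDiff_affine a t))
    have hXc : ∀ i, HasCompactSupport (X i) := fun i =>
      hcs_ker.mul_right (f' := fun z => pd H i (a + t • z))
    have z0 : ∀ i, ∫ x, pd (X i) i x = 0 := fun i => integral_pd_eq_zero (hXs i) (hXc i) i
    have pX : ∀ i z, pd (X i) i z = - psi z * z i * pd H i (a + t • z) +
        kerP z * (t * pd (pd H i) i (a + t • z)) := by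
      intro i z
      have d1 : DifferentiableAt ℝ kerP z := contDiff_ker.contDiffAt.differentiableAt (by simp)
      have d2 : DifferentiableAt ℝ (fun z => pd H i (a + t • z)) z :=
        ((smooth_pd hH i).comp (contDiff_affine a t)).contDiffAt.differentiableAt (by simp)
      rw [hX]
      simp only
      rw [pd_mul d1 d2, pd_ker, pd_affine (smooth_pd hH i)]
    have iX : ∀ i, Integrable (pd (X i) i) := fun i => by
      refine Continuous.integrable_of_hasCompactSupport ?_ (hcs_pd (hXc i) i)
      rw [show pd (X i) i = _ from funext (pX i)]
      have c2 := (smooth_pd (smooth_pd hH i) i).continuous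
      have c3 := (smooth_pd hH i).continuous
      have c4 := contDiff_ker.continuous
      have c5 := (contDiff_coord (n := 0) i).continuous
      exact ((hpsi.neg.mul c5).mul (c3.comp (ca t))).add
        (c4.mul (continuous_const.mul (c2.comp (ca t))))
    have ik : Integrable (k t) := key.1
    have e1 : ∀ z, k t z + (pd (X 0) 0 z + pd (X 1) 1 z) = t * (kerP z * lap H (a + t • z)) := by
      intro z
      rw [pX, pX]; simp only [hk, lap]; ring
    rw [← integral_const_mul, ← integral_congr_ae (Eventually.of_forall e1)]
    have i4 : Integrable fun z => pd (X 0) 0 z + pd (X 1) 1 z := (iX 0).add (iX 1)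
    rw [integral_add ik i4, integral_add (iX 0) (iX 1), z0, z0]
    simp
  rw [← e]
  exact h2

/-! ### A logarithmic bound for `u` -/

lemma continuous_lap {H : Pl → ℝ} (hH : ContDiff ℝ (⊤ : ℕ∞) H) : Continuous (lap H) :=
  (smooth_pd (smooth_pd hH 0) 0).continuous.add (smooth_pd (smooth_pd hH 1) 1).continuous

lemma integrable_ker_lap {H : Pl → ℝ} (hH : ContDiff ℝ (⊤ : ℕ∞) H) (a : Pl) (s : ℝ) :
    Integrable (fun z => kerP z * lap H (a + s • z)) :=
  Continuous.integrable_of_hasCompactSupport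
    (contDiff_ker.continuous.mul ((continuous_lap hH).comp (contDiff_affine (n := 0) a s).continuous))
    (hcs_ker.mul_right (f' := fun z => lap H (a + s • z)))

lemma integrable_psi_mul {H : Pl → ℝ} (hH : Continuous H) (a : Pl) (s : ℝ) :
    Integrable (fun z => psi z * H (a + s • z)) :=
  Continuous.integrable_of_hasCompactSupport
    (continuous_psi.mul (hH.comp (contDiff_affine (n := 0) a s).continuous))
    (hcs_psi.mul_right (f' := fun z => H (a + s • z)))

lemma Phi_le_log {H : Pl → ℝ} (hH : ContDiff ℝ (⊤ : ℕ∞) H) (hg : Integrable (lap H)) {t : ℝ}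
    (ht : 1 ≤ t) : Phi H 0 t ≤ Phi H 0 1 + (∫ x, |lap H x|) * Real.log t := by
  set M := ∫ x, |lap H x| with hM
  have hd : ∀ s : ℝ, 0 < s → HasDerivAt (fun s => Phi H 0 s - M * Real.log s)
      (s * (∫ z, kerP z * lap H (0 + s • z)) - M * s⁻¹) s := fun s hs =>
    (hasDerivAt_Phi hH 0 s).sub ((Real.hasDerivAt_log hs.ne').const_mul M)
  have hnp : ∀ s : ℝ, 0 < s → s * (∫ z, kerP z * lap H (0 + s • z)) - M * s⁻¹ ≤ 0 := by
    intro s hs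
    have e := Measure.integral_comp_smul (volume : Measure Pl) (fun x => |lap H x|) s
    have hi : Integrable (fun z : Pl => |lap H (s • z)|) := (hg.comp_smul hs.ne').abs
    have h1 : (∫ z, kerP z * lap H (0 + s • z)) ≤ ∫ z : Pl, |lap H (s • z)| := by
      refine integral_mono (integrable_ker_lap hH 0 s) hi ?_
      intro z
      simp only [zero_add]
      have h1 := le_abs_self (lap H (s • z))
      have h2 := abs_nonneg (lap H (s • z))
      have h3 := ker_nonneg z
      have h4 := ker_le z
      nlinarith
    rw [e, finrank_euclideanSpace_fin, abs_of_pos (by positivity), smul_eq_mul, ← hM] at h1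
    have h2 := mul_le_mul_of_nonneg_left h1 hs.le
    have h3 : s * ((s ^ 2)⁻¹ * M) = M * s⁻¹ := by field_simp
    linarith
  have ha : AntitoneOn (fun s => Phi H 0 s - M * Real.log s) (Ici 1) := by
    have pos : ∀ s ∈ Ici (1:ℝ), 0 < s := fun s hs => lt_of_lt_of_le one_pos hs
    refine antitoneOn_of_deriv_nonpos (convex_Ici 1)
      (fun s hs => (hd s (pos s hs)).continuousAt.continuousWithinAt)
      (fun s hs => (hd s (pos s (interior_subset hs))).differentiableAt.differentiableWithinAt)
      (fun s hs => ?_)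
    rw [(hd s (pos s (interior_subset hs))).deriv]
    exact hnp s (pos s (interior_subset hs))
  have := ha (mem_Ici.2 le_rfl) (mem_Ici.2 ht) ht
  simp at this
  linarith

lemma Phi_zero_le {H : Pl → ℝ} (hH : ContDiff ℝ (⊤ : ℕ∞) H) {x : Pl} {T : ℝ} (hT : 0 < T)
    (hpos : ∀ y, ‖y - x‖ < T → 0 ≤ lap H y) : H x * (∫ z, psi z) ≤ Phi H x T := by
  have h0 : Phi H x 0 = H x * ∫ z, psi z := by
    unfold Phi
    simp only [zero_smul, add_zero]
    rw [integral_mul_const, mul_comm]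
  rw [← h0]
  have hm : MonotoneOn (Phi H x) (Icc 0 T) := by
    refine monotoneOn_of_deriv_nonneg (convex_Icc 0 T)
      (fun s _ => (hasDerivAt_Phi hH x s).continuousAt.continuousWithinAt)
      (fun s _ => (hasDerivAt_Phi hH x s).differentiableAt.differentiableWithinAt)
      (fun s hs => ?_)
    rw [interior_Icc] at hs
    rw [(hasDerivAt_Phi hH x s).deriv]
    refine mul_nonneg hs.1.le (integral_nonneg fun z => ?_)
    by_cases hz : 1 ≤ ‖z‖
    · simp [ker_zero hz]
    · refine mul_nonneg (ker_nonneg z) (hpos _ ?_)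
      push Not at hz
      rw [add_sub_cancel_left, norm_smul, Real.norm_of_nonneg hs.1.le]
      nlinarith [hs.1, hs.2, norm_nonneg z]
  exact hm ⟨le_rfl, hT.le⟩ ⟨hT.le, le_rfl⟩ hT.le

lemma Phi_compare {H : Pl → ℝ} (hH : Continuous H) (h0 : ∀ x, 0 ≤ H x) {x : Pl} {T : ℝ}
    (hT : 0 < T) (hx : ‖x‖ = 2 * T) : Phi H x T ≤ 48 * Phi H 0 (6 * T) := by
  set c : Pl := T⁻¹ • x with hc
  set g : Pl → ℝ := fun z => psi z * H (0 + (6 * T) • z) with hg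
  have hgi : Integrable g := integrable_psi_mul hH 0 (6 * T)
  have hgi2 : Integrable (fun z : Pl => g ((1/6 : ℝ) • z)) := hgi.comp_smul (by norm_num)
  have e1 : ∫ z : Pl, g ((1/6 : ℝ) • (z + c)) = 36 * ∫ z, g z := by
    rw [integral_add_right_eq_self (fun z : Pl => g ((1/6 : ℝ) • z)) c,
      Measure.integral_comp_smul, finrank_euclideanSpace_fin]
    rw [smul_eq_mul]; norm_num
  have hle : ∀ z, psi z * H (x + T • z) ≤ (4 / 3) * g ((1/6 : ℝ) • (z + c)) := by
    intro z
    have e : (0:Pl) + (6 * T) • ((1/6 : ℝ) • (z + c)) = x + T • z := by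
      rw [zero_add, smul_smul, hc, smul_add, smul_smul,
        show 6 * T * (1 / 6) = T by ring, mul_inv_cancel₀ hT.ne', one_smul, add_comm]
    simp only [hg]
    rw [e]
    have hH0 := h0 (x + T • z)
    by_cases hz : 1 ≤ ‖z‖
    · rw [psi_zero hz, zero_mul]
      have := psi_nonneg ((1/6 : ℝ) • (z + c))
      positivity
    · push Not at hz
      have hcn : ‖c‖ = 2 := by
        rw [hc, norm_smul, norm_inv, Real.norm_of_nonneg hT.le, hx]; field_simp
      have h3 : 3 ≤ psi ((1/6 : ℝ) • (z + c)) := by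
        apply psi_ge
        rw [norm_smul]
        have := norm_add_le z c
        norm_num
        linarith
      have h4 := psi_le z
      nlinarith
  have := integral_mono (integrable_psi_mul hH x T) ((hgi2.comp_add_right c).const_mul (4/3)) hle
  rw [integral_const_mul, e1] at this
  unfold Phi
  linarith

lemma integral_psi_pos : 0 < ∫ z, psi z := by
  have hi : Integrable psi := continuous_psi.integrable_of_hasCompactSupport hcs_psi
  refine (continuous_psi.integral_pos_of_hasCompactSupport_nonneg_nonzero hcs_psi psi_nonneg
    (x := 0) ?_)
  have := psi_ge (z := 0) (by simp)
  linarith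

/-- A cut-off of `-u`. -/
lemma exists_H {u : Pl → ℝ} (hsm : ContDiffOn ℝ (⊤ : ℕ∞) u {(0:Pl)}ᶜ)
    (hle : ∀ x : Pl, x ≠ 0 → u x ≤ 0) :
    ∃ H : Pl → ℝ, ContDiff ℝ (⊤ : ℕ∞) H ∧ (∀ x, 0 ≤ H x) ∧ (∀ x, 2 < ‖x‖ → H x = - u x) := by
  let b : ContDiffBump (0:Pl) := ⟨1, 2, by norm_num, by norm_num⟩
  refine ⟨fun x => (1 - b x) * (- u x), ?_, ?_, ?_⟩
  · rw [contDiff_iff_contDiffAt]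
    intro x
    by_cases hx : x = 0
    · subst hx
      have : (fun x => (1 - b x) * (- u x)) =ᶠ[𝓝 0] fun _ => 0 := by
        filter_upwards [b.eventuallyEq_one] with y hy
        rw [hy]; simp
      exact contDiffAt_const.congr_of_eventuallyEq this
    · exact (contDiffAt_const.sub b.contDiff.contDiffAt).mul (smoothAt_ev hsm hx).neg
  · intro x
    by_cases hx : x = 0
    · subst hx
      have : b 0 = 1 := b.eventuallyEq_one.self_of_nhds
      simp [this]
    · exact mul_nonneg (by linarith [b.le_one (x := x)]) (by linarith [hle x hx])
  · intro x hx
    have : b x = 0 := b.zero_of_le_dist (by simpa [b] using hx.le)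
    simp [this]

lemma deriv_H {u H : Pl → ℝ} (hsm : ContDiffOn ℝ (⊤ : ℕ∞) u {(0:Pl)}ᶜ)
    (Hu : ∀ x, 2 < ‖x‖ → H x = - u x) {x : Pl} (hx : 2 < ‖x‖) :
    (∀ i, pd H i x = - pd u i x) ∧ lap H x = - lap u x := by
  have hx0 : x ≠ 0 := by rintro rfl; simp at hx; linarith
  have hev : ∀ᶠ y in 𝓝 x, 2 < ‖y‖ := continuous_norm.continuousAt.eventually (lt_mem_nhds hx)
  have h1 : H =ᶠ[𝓝 x] fun y => - u y := hev.mono Hu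
  have h2 : ∀ i, pd H i =ᶠ[𝓝 x] fun y => - pd u i y := by
    intro i
    filter_upwards [pd_congr_ev h1 i, smooth_ev isOpen_compl_singleton hsm hx0] with y hy hy2
    rw [hy, pd_neg (smoothAt_diff hy2)]
  have hs := smoothAt_ev hsm hx0
  have h3 : ∀ i, pd (pd H i) i x = - pd (pd u i) i x := by
    intro i
    rw [pd_congr (h2 i), pd_neg (smoothAt_diff (smoothAt_pd hs i))]
  refine ⟨fun i => (h2 i).self_of_nhds, ?_⟩
  unfold lap
  rw [h3, h3]; ring

lemma u_log_bound {τ : ℝ} (hτ : 0 < τ) {u : Pl → ℝ}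
    (hsm : ContDiffOn ℝ (⊤ : ℕ∞) u {(0:Pl)}ᶜ)
    (hpde : ∀ x : Pl, x ≠ 0 → lap u x + fτ τ (u x) = 0)
    (hL1 : Integrable (fun x : Pl => fτ τ (u x)))
    (hle : ∀ x : Pl, x ≠ 0 → u x ≤ 0) :
    ∃ B : ℝ, 0 ≤ B ∧ ∀ x : Pl, 5 ≤ ‖x‖ → - u x ≤ B * Real.log ‖x‖ := by
  obtain ⟨H, hH, H0, Hu⟩ := exists_H hsm hle
  have hlap : ∀ x : Pl, 2 < ‖x‖ → lap H x = fτ τ (u x) := by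
    intro x hx
    have hx0 : x ≠ 0 := by rintro rfl; simp at hx; linarith
    have := hpde x hx0
    rw [(deriv_H hsm Hu hx).2]; linarith
  have hg : Integrable (lap H) := by
    rw [← integrableOn_univ, ← union_compl_self (closedBall (0:Pl) 2)]
    refine IntegrableOn.union ((continuous_lap hH).continuousOn.integrableOn_compact
      (isCompact_closedBall 0 2)) ?_
    refine (hL1.integrableOn (s := (closedBall (0:Pl) 2)ᶜ)).congr_fun ?_
      measurableSet_closedBall.compl
    intro x hx
    exact (hlap x (by simpa using hx)).symm
  set M := ∫ x, |lap H x| with hM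
  have M0 : 0 ≤ M := integral_nonneg fun _ => abs_nonneg _
  set I := ∫ z, psi z with hI
  have I0 : 0 < I := integral_psi_pos
  have l3 : 0 ≤ Real.log 3 := Real.log_nonneg (by norm_num)
  refine ⟨48 * (|Phi H 0 1| + M * (Real.log 3 + 1)) / I, by positivity, ?_⟩
  intro x hx
  have hl : 1 ≤ Real.log ‖x‖ := by
    rw [Real.le_log_iff_exp_le (by linarith)]
    have := Real.exp_one_lt_d9
    linarith
  have a1 := Phi_zero_le hH (x := x) (T := ‖x‖ / 2) (by linarith) (by
    intro y hy
    have h1 : ‖x‖ ≤ ‖y‖ + ‖y - x‖ := by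
      have := norm_sub_le y (y - x)
      simpa using this
    have h2 : 2 < ‖y‖ := by linarith
    rw [hlap y h2]
    exact fτ_nonneg hτ (hle y (by rintro rfl; simp at h2; linarith)))
  have a2 := Phi_compare hH.continuous H0 (x := x) (T := ‖x‖ / 2) (by linarith) (by ring)
  have a3 := Phi_le_log hH hg (t := 6 * (‖x‖ / 2)) (by linarith)
  rw [Hu x (by linarith), ← hI] at a1
  rw [show 6 * (‖x‖ / 2) = 3 * ‖x‖ by ring] at a2 a3
  rw [Real.log_mul (by norm_num) (by linarith), ← hM] at a3
  have a4 := le_abs_self (Phi H 0 1)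
  rw [div_mul_eq_mul_div, le_div_iff₀ I0]
  have a5 : |Phi H 0 1| ≤ |Phi H 0 1| * Real.log ‖x‖ := le_mul_of_one_le_right (abs_nonneg _) hl
  have a6 : M * Real.log 3 ≤ M * Real.log 3 * Real.log ‖x‖ := le_mul_of_one_le_right (by positivity) hl
  nlinarith

/-! ### Logarithmic cut-offs -/

lemma cut_const {A : ℝ → ℝ} {c S : ℝ} (hS : 0 < S) (hA0 : ∀ s ≤ 1 / 2, A s = c) {x : Pl}
    (hx : x = 0 ∨ Real.log ‖x‖ ≤ S / 2) : A (Real.log ‖x‖ / S) = c := by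
  apply hA0
  rcases hx with rfl | hx
  · simp
  · rw [div_le_iff₀ hS]; linarith

lemma cut_smooth {A : ℝ → ℝ} (hA : ContDiff ℝ (⊤ : ℕ∞) A) {c S : ℝ} (hS : 0 < S)
    (hA0 : ∀ s ≤ 1 / 2, A s = c) : ContDiff ℝ (⊤ : ℕ∞) (fun x : Pl => A (Real.log ‖x‖ / S)) := by
  rw [contDiff_iff_contDiffAt]
  intro x
  by_cases hx : x = 0
  · subst hx
    have : (fun x : Pl => A (Real.log ‖x‖ / S)) =ᶠ[𝓝 0] fun _ => c := by
      filter_upwards [ball_mem_nhds (0:Pl) one_pos] with y hy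
      refine cut_const hS hA0 (Or.inr ?_)
      have : Real.log ‖y‖ ≤ 0 := Real.log_nonpos (norm_nonneg _) (by simpa using (mem_ball_zero_iff.1 hy).le)
      linarith
    exact contDiffAt_const.congr_of_eventuallyEq this
  · exact hA.contDiffAt.comp x ((smoothAt_log hx).div_const S)

lemma cut_hcs {A : ℝ → ℝ} {S : ℝ} (hS : 0 < S) (hA1 : ∀ s, 5 / 2 ≤ s → A s = 0) :
    HasCompactSupport (fun x : Pl => A (Real.log ‖x‖ / S)) := by
  refine HasCompactSupport.intro (isCompact_closedBall (0:Pl) (exp (5 / 2 * S))) fun x hx => hA1 _ ?_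
  simp at hx
  rw [le_div_iff₀ hS]
  rw [Real.le_log_iff_exp_le (lt_trans (exp_pos _) hx)]
  exact hx.le

lemma cut_gradSq {A : ℝ → ℝ} (hA : ContDiff ℝ (⊤ : ℕ∞) A) (S : ℝ) {x : Pl} (hx : x ≠ 0) :
    gradSq (fun x : Pl => A (Real.log ‖x‖ / S)) x =
      deriv A (Real.log ‖x‖ / S) ^ 2 / (S ^ 2 * ‖x‖ ^ 2) := by
  have dl := smoothAt_diff (smoothAt_log hx)
  have hA' : HasDerivAt (fun t => A (t / S)) (deriv A (Real.log ‖x‖ / S) * (1 / S)) (Real.log ‖x‖) := by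
    have h1 : HasDerivAt A (deriv A (Real.log ‖x‖ / S)) (Real.log ‖x‖ / S) :=
      (hA.differentiable (by simp) _).hasDerivAt
    exact h1.comp (Real.log ‖x‖) ((hasDerivAt_id _).div_const S)
  have hn : x 0 ^ 2 + x 1 ^ 2 ≠ 0 := sumsq_ne hx
  unfold gradSq
  rw [pd_comp dl hA', pd_comp dl hA', pd_log hx, pd_log hx, normSq_eq]
  by_cases hS : S = 0
  · simp [hS]
  · field_simp

lemma deriv_profile {A : ℝ → ℝ} {a b c d : ℝ} (h1 : ∀ s ≤ a, A s = c) (h2 : ∀ s, b ≤ s → A s = d)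
    {s : ℝ} (hs : s < a ∨ b < s) : deriv A s = 0 := by
  rcases hs with hs | hs
  · have : A =ᶠ[𝓝 s] fun _ => c := by
      filter_upwards [gt_mem_nhds hs] with y hy using h1 y (le_of_lt hy)
    rw [this.deriv_eq]; simp
  · have : A =ᶠ[𝓝 s] fun _ => d := by
      filter_upwards [lt_mem_nhds hs] with y hy using h2 y (le_of_lt hy)
    rw [this.deriv_eq]; simp

lemma deriv_profile_bdd {A : ℝ → ℝ} (hA : ContDiff ℝ (⊤ : ℕ∞) A) {a b c d : ℝ}
    (h1 : ∀ s ≤ a, A s = c) (h2 : ∀ s, b ≤ s → A s = d) : ∃ C, 0 ≤ C ∧ ∀ s, deriv A s ^ 2 ≤ C := by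
  have hc : Continuous (deriv A) := hA.continuous_deriv (by simp)
  obtain ⟨C, hC⟩ := (isCompact_Icc (a := a) (b := b)).exists_bound_of_continuousOn (hc.pow 2).continuousOn
  refine ⟨max C 0, le_max_right _ _, fun s => ?_⟩
  by_cases hs : s ∈ Icc a b
  · have := hC s hs
    rw [Real.norm_eq_abs] at this
    exact (le_abs_self _).trans (this.trans (le_max_left _ _))
  · rw [deriv_profile h1 h2]
    · simp
    · rw [mem_Icc, not_and_or, not_le, not_le] at hs; exact hs

lemma exists_A : ∃ A : ℝ → ℝ, ContDiff ℝ (⊤ : ℕ∞) A ∧ (∀ s, 0 ≤ A s ∧ A s ≤ 1) ∧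
    (∀ s ≤ 1, A s = 1) ∧ (∀ s, 2 ≤ s → A s = 0) := by
  refine ⟨fun s => Real.smoothTransition (2 - s), ?_, ?_, ?_, ?_⟩
  · exact Real.smoothTransition.contDiff.comp (contDiff_const.sub contDiff_id)
  · exact fun s => ⟨Real.smoothTransition.nonneg _, Real.smoothTransition.le_one _⟩
  · exact fun s hs => Real.smoothTransition.one_of_one_le (by linarith)
  · exact fun s hs => Real.smoothTransition.zero_of_nonpos (by linarith)

lemma exists_Z : ∃ Z : ℝ → ℝ, ContDiff ℝ (⊤ : ℕ∞) Z ∧ (∀ s ∈ Icc (1:ℝ) 2, Z s = 1) ∧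
    (∀ s ≤ 1 / 2, Z s = 0) ∧ (∀ s, 5 / 2 ≤ s → Z s = 0) := by
  let b : ContDiffBump (3 / 2 : ℝ) := ⟨1 / 2, 1, by norm_num, by norm_num⟩
  refine ⟨b, b.contDiff, ?_, ?_, ?_⟩
  · intro s hs
    apply b.one_of_mem_closedBall
    rw [mem_closedBall, Real.dist_eq, abs_le]
    constructor <;> simp only [b] <;> linarith [hs.1, hs.2]
  · intro s hs
    apply b.zero_of_le_dist
    rw [Real.dist_eq, abs_of_nonpos (by linarith)]
    simp only [b]; linarith
  · intro s hs
    apply b.zero_of_le_dist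
    rw [Real.dist_eq, abs_of_nonneg (by linarith)]
    simp only [b]; linarith

/-- Caccioppoli's inequality. -/
lemma caccioppoli {H ζ : Pl → ℝ} (hH : ContDiff ℝ (⊤ : ℕ∞) H) (hζ : ContDiff ℝ (⊤ : ℕ∞) ζ)
    (hc : HasCompactSupport ζ) (hpos : ∀ x, ζ x ≠ 0 → 0 ≤ H x * lap H x) :
    ∫ x, ζ x ^ 2 * gradSq H x ≤ 4 * ∫ x, H x ^ 2 * gradSq ζ x := by
  have hζ2 : HasCompactSupport (fun y => ζ y ^ 2) := hc.comp_left (g := fun t : ℝ => t ^ 2) (by simp)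
  set X : Fin 2 → Pl → ℝ := fun i y => (ζ y ^ 2 * H y) * pd H i y with hX
  have hXs : ∀ i, ContDiff ℝ (⊤ : ℕ∞) (X i) := fun i => ((hζ.pow 2).mul hH).mul (smooth_pd hH i)
  have hXc : ∀ i, HasCompactSupport (X i) := fun i =>
    (hζ2.mul_right (f' := H)).mul_right (f' := pd H i)
  have z0 : ∀ i, ∫ x, pd (X i) i x = 0 := fun i =>
    integral_pd_eq_zero ((hXs i).of_le (by exact_mod_cast le_top)) (hXc i) i
  have iX : ∀ i, Integrable (pd (X i) i) := fun i =>
    (smooth_pd (hXs i) i).continuous.integrable_of_hasCompactSupport (hcs_pd (hXc i) i)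
  have i1 : Integrable (fun x => ζ x ^ 2 * gradSq H x) :=
    ((hζ.pow 2).continuous.mul (continuous_gradSq hH)).integrable_of_hasCompactSupport
      (hζ2.mul_right (f' := gradSq H))
  have i2 : Integrable (fun x => H x ^ 2 * gradSq ζ x) :=
    ((hH.pow 2).continuous.mul (continuous_gradSq hζ)).integrable_of_hasCompactSupport
      ((hcs_gradSq hc).mul_left (f := fun x => H x ^ 2))
  have pX : ∀ i x, pd (X i) i x = 2 * ζ x * pd ζ i x * H x * pd H i x + ζ x ^ 2 * pd H i x ^ 2 +
      ζ x ^ 2 * H x * pd (pd H i) i x := by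
    intro i x
    have dζ := smooth_diff hζ x
    have dH := smooth_diff hH x
    have dp := smooth_diff (smooth_pd hH i) x
    have hp : HasDerivAt (fun t : ℝ => t ^ 2) (2 * ζ x) (ζ x) := by
      simpa using hasDerivAt_pow 2 (ζ x)
    simp only [hX]
    rw [pd_mul ((dζ.fun_pow 2).fun_mul dH) dp, pd_mul (dζ.fun_pow 2) dH, pd_comp dζ hp]
    ring
  have hle : ∀ x, ζ x ^ 2 * gradSq H x ≤ 2 * (pd (X 0) 0 x + pd (X 1) 1 x) +
      4 * (H x ^ 2 * gradSq ζ x) := by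
    intro x
    have h1 : 0 ≤ ζ x ^ 2 * (H x * lap H x) := by
      by_cases h : ζ x = 0
      · simp [h]
      · exact mul_nonneg (sq_nonneg _) (hpos x h)
    rw [pX, pX]
    unfold gradSq
    unfold lap at h1
    nlinarith [sq_nonneg (ζ x * pd H 0 x + 2 * H x * pd ζ 0 x),
      sq_nonneg (ζ x * pd H 1 x + 2 * H x * pd ζ 1 x)]
  have i4 : Integrable fun z => pd (X 0) 0 z + pd (X 1) 1 z := (iX 0).add (iX 1)
  have := integral_mono i1 ((i4.const_mul 2).add (i2.const_mul 4)) hle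
  simp only [Pi.add_apply] at this
  rw [integral_add (i4.const_mul 2) (i2.const_mul 4), integral_const_mul, integral_const_mul,
    integral_add (iX 0) (iX 1), z0, z0] at this
  linarith

/-- The integral of `‖x‖⁻²` over an annulus. -/
lemma annulus {a b : ℝ} (ha : 0 < a) (hab : a ≤ b) :
    Integrable (fun x : Pl => (Icc a b).indicator (fun r => (r ^ 2)⁻¹) ‖x‖) ∧
    ∫ x : Pl, (Icc a b).indicator (fun r => (r ^ 2)⁻¹) ‖x‖ =
      2 * (volume : Measure Pl).real (ball 0 1) * Real.log (b / a) := by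
  constructor
  · have e : (fun x : Pl => (Icc a b).indicator (fun r : ℝ => (r ^ 2)⁻¹) ‖x‖) =
        (norm ⁻¹' (Icc a b)).indicator (fun x : Pl => (‖x‖ ^ 2)⁻¹) := rfl
    rw [e, integrable_indicator_iff (measurableSet_Icc.preimage measurable_norm)]
    have hcl : IsClosed (norm ⁻¹' (Icc a b) : Set Pl) := isClosed_Icc.preimage continuous_norm
    have hcp : IsCompact (norm ⁻¹' (Icc a b) : Set Pl) :=
      (isCompact_closedBall (0:Pl) b).of_isClosed_subset hcl fun x hx => by simpa using hx.2
    refine ContinuousOn.integrableOn_compact hcp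
      ((continuous_norm.pow 2).continuousOn.inv₀ fun x hx => ?_)
    have : a ≤ ‖x‖ := hx.1
    have h3 : 0 < ‖x‖ := by linarith
    exact (pow_pos h3 2).ne'
  · have h := integral_fun_norm_addHaar (volume : Measure Pl) ((Icc a b).indicator (fun r : ℝ => (r ^ 2)⁻¹))
    rw [h, finrank_euclideanSpace_fin]
    have e : ∀ y : ℝ, y ^ (2 - 1) • (Icc a b).indicator (fun r : ℝ => (r ^ 2)⁻¹) y =
        (Icc a b).indicator (fun r : ℝ => r⁻¹) y := by
      intro y
      by_cases hy : y ∈ Icc a b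
      · have : 0 < y := lt_of_lt_of_le ha hy.1
        simp only [indicator_of_mem hy, smul_eq_mul]; field_simp; simp
      · simp [indicator_of_notMem hy]
    simp only [e]
    rw [setIntegral_indicator measurableSet_Icc,
      show Ioi (0:ℝ) ∩ Icc a b = Icc a b from inter_eq_right.2 fun y hy => lt_of_lt_of_le ha hy.1,
      integral_Icc_eq_integral_Ioc, ← intervalIntegral.integral_of_le hab,
      integral_inv_of_pos ha (lt_of_lt_of_le ha hab)]
    simp
    ring

/-! ### The gradient term of the logarithmic cut-off -/

lemma wf_sq_le (u : Pl → ℝ) (x : Pl) : wf u x ^ 2 ≤ ‖x‖ ^ 2 * gradSq u x := by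
  rw [normSq_eq]; unfold wf gradSq
  nlinarith [sq_nonneg (x 0 * pd u 1 x - x 1 * pd u 0 x)]

lemma int_grad_mul {η g : Pl → ℝ} (hη : ContDiff ℝ (⊤ : ℕ∞) η) (hc : HasCompactSupport η)
    (hg : Continuous g) : Integrable (fun x => gradSq η x * g x) :=
  ((continuous_gradSq hη).mul hg).integrable_of_hasCompactSupport
    ((hcs_gradSq hc).mul_right (f' := g))

lemma int_mul_grad {ζ H : Pl → ℝ} (hζ : ContDiff ℝ (⊤ : ℕ∞) ζ) (hc : HasCompactSupport ζ)
    (hH : ContDiff ℝ (⊤ : ℕ∞) H) : Integrable (fun x => ζ x ^ 2 * gradSq H x) := by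
  have hζ2 : HasCompactSupport (fun y => ζ y ^ 2) := hc.comp_left (g := fun t : ℝ => t ^ 2) (by simp)
  exact ((hζ.pow 2).continuous.mul (continuous_gradSq hH)).integrable_of_hasCompactSupport
      (hζ2.mul_right (f' := gradSq H))

set_option maxHeartbeats 1000000 in
lemma exists_cutoff {τ : ℝ} (hτ : 0 < τ) {u : Pl → ℝ}
    (hsm : ContDiffOn ℝ (⊤ : ℕ∞) u {(0:Pl)}ᶜ)
    (hpde : ∀ x : Pl, x ≠ 0 → lap u x + fτ τ (u x) = 0)
    (hL1 : Integrable (fun x : Pl => fτ τ (u x)))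
    (hle : ∀ x : Pl, x ≠ 0 → u x ≤ 0) :
    ∃ C : ℝ, 0 ≤ C ∧ ∀ S : ℝ, 4 ≤ S → ∃ η : Pl → ℝ, ContDiff ℝ (⊤ : ℕ∞) η ∧ HasCompactSupport η ∧
      (∀ x, 0 ≤ η x ∧ η x ≤ 1) ∧ (∀ x, Real.log ‖x‖ ≤ S → η x = 1) ∧
      Integrable (fun x => gradSq η x * wf u x ^ 2) ∧
      ∫ x, gradSq η x * wf u x ^ 2 ≤ C / S := by
  obtain ⟨B, hB0, hB⟩ := u_log_bound hτ hsm hpde hL1 hle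
  obtain ⟨H, hH, H0, Hu⟩ := exists_H hsm hle
  obtain ⟨A, hA, hA01, hA1, hA2⟩ := exists_A
  obtain ⟨Z, hZ, hZ1, hZ0, hZ2⟩ := exists_Z
  obtain ⟨CA, hCA0, hCA⟩ := deriv_profile_bdd hA hA1 hA2
  obtain ⟨CZ, hCZ0, hCZ⟩ := deriv_profile_bdd hZ hZ0 hZ2
  set V := (volume : Measure Pl).real (ball 0 1) with hV
  have hV0 : 0 ≤ V := measureReal_nonneg
  refine ⟨CA * (4 * (B ^ 2 * 25 / 4 * CZ * (2 * V * 2))), by positivity, ?_⟩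
  intro S hS
  have hS0 : 0 < S := by linarith
  have hexp : 5 < exp (S / 2) := by
    have h1 : (1 + 1 : ℝ) ≤ exp 1 := Real.add_one_le_exp 1
    have h2 : exp 2 ≤ exp (S / 2) := Real.exp_le_exp.2 (by linarith)
    have h3 : exp 2 = exp 1 * exp 1 := by rw [← Real.exp_add]; norm_num
    have := Real.exp_one_gt_d9
    nlinarith
  -- far points
  have far : ∀ x : Pl, S / 2 ≤ Real.log ‖x‖ → 5 < ‖x‖ := by
    intro x hx
    by_cases h : x = 0
    · subst h; simp at hx; linarith
    · have := (Real.le_log_iff_exp_le (norm_pos_iff.2 h)).1 hx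
      linarith
  set η : Pl → ℝ := fun x => A (Real.log ‖x‖ / S) with hη
  set ζ : Pl → ℝ := fun x => Z (Real.log ‖x‖ / S) with hζ
  have hηs : ContDiff ℝ (⊤ : ℕ∞) η := cut_smooth hA hS0 (c := 1) fun s hs => hA1 s (by linarith)
  have hζs : ContDiff ℝ (⊤ : ℕ∞) ζ := cut_smooth hZ hS0 hZ0
  have hηc : HasCompactSupport η := cut_hcs hS0 fun s hs => hA2 s (by linarith)
  have hζc : HasCompactSupport ζ := cut_hcs hS0 hZ2
  have wfeq : ∀ x : Pl, 2 < ‖x‖ → wf u x = - wf H x := by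
    intro x hx
    unfold wf
    rw [(deriv_H hsm Hu hx).1, (deriv_H hsm Hu hx).1]; ring
  have gη : ∀ x : Pl, gradSq η x ≠ 0 → x ≠ 0 ∧ S ≤ Real.log ‖x‖ ∧ Real.log ‖x‖ ≤ 2 * S := by
    intro x hx
    by_cases h : x = 0
    · subst h
      exfalso; apply hx
      have : η =ᶠ[𝓝 0] fun _ => 1 := by
        filter_upwards [ball_mem_nhds (0:Pl) one_pos] with y hy
        refine cut_const hS0 (fun s hs => hA1 s (by linarith)) (Or.inr ?_)
        have : Real.log ‖y‖ ≤ 0 := Real.log_nonpos (norm_nonneg _) (by simpa using (mem_ball_zero_iff.1 hy).le)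
        linarith
      unfold gradSq
      rw [pd_congr this, pd_congr this, pd_const, pd_const]; simp
    · refine ⟨h, ?_⟩
      rw [hη, cut_gradSq hA S h] at hx
      by_contra hcon
      apply hx
      rw [not_and_or, not_le, not_le] at hcon
      rw [deriv_profile hA1 hA2 (s := Real.log ‖x‖ / S)]
      · simp
      · rw [div_lt_iff₀ hS0, lt_div_iff₀ hS0, one_mul]; exact hcon
  have eqw : (fun x => gradSq η x * wf u x ^ 2) = fun x => gradSq η x * wf H x ^ 2 := by
    funext x
    by_cases h : gradSq η x = 0
    · simp [h]
    · have h2 := far x (by linarith [(gη x h).2.1])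
      rw [wfeq x (by linarith)]; ring
  have hwfc : Continuous (wf H) :=
    ((contDiff_coord (n := 0) 0).continuous.mul (smooth_pd hH 0).continuous).add
      ((contDiff_coord (n := 0) 1).continuous.mul (smooth_pd hH 1).continuous)
  have i1 : Integrable (fun x => gradSq η x * wf u x ^ 2) := by
    rw [eqw]
    exact int_grad_mul hηs hηc (hwfc.pow 2)
  have i2 : Integrable (fun x => ζ x ^ 2 * gradSq H x) := int_mul_grad hζs hζc hH
  have i3 : Integrable (fun x => H x ^ 2 * gradSq ζ x) := by
    simp_rw [mul_comm (H _ ^ 2)]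
    exact int_grad_mul hζs hζc (hH.continuous.pow 2)
  have s1 : ∫ x, gradSq η x * wf u x ^ 2 ≤ CA / S ^ 2 * ∫ x, ζ x ^ 2 * gradSq H x := by
    rw [← integral_const_mul]
    refine integral_mono i1 (i2.const_mul _) fun x => ?_
    have hg := gradSq_nonneg H x
    simp only
    by_cases h : gradSq η x = 0
    · rw [h, zero_mul]; positivity
    · obtain ⟨hx0, h1, h2⟩ := gη x h
      have hn : 0 < ‖x‖ := norm_pos_iff.2 hx0
      have h5 := far x (by linarith)
      have hz : ζ x = 1 := hZ1 _ ⟨by rw [le_div_iff₀ hS0]; linarith, by rw [div_le_iff₀ hS0]; linarith⟩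
      rw [wfeq x (by linarith), hz, neg_sq, one_pow, one_mul]
      have e : gradSq η x = deriv A (Real.log ‖x‖ / S) ^ 2 / (S ^ 2 * ‖x‖ ^ 2) := cut_gradSq hA S hx0
      rw [e]
      calc deriv A (Real.log ‖x‖ / S) ^ 2 / (S ^ 2 * ‖x‖ ^ 2) * wf H x ^ 2
          ≤ CA / (S ^ 2 * ‖x‖ ^ 2) * (‖x‖ ^ 2 * gradSq H x) := by
            gcongr
            · exact hCA _
            · exact wf_sq_le H x
        _ = CA / S ^ 2 * gradSq H x := by field_simp
  have s2 : ∫ x, ζ x ^ 2 * gradSq H x ≤ 4 * ∫ x, H x ^ 2 * gradSq ζ x := by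
    refine caccioppoli hH hζs hζc fun x hx => ?_
    have h5 : 5 < ‖x‖ := by
      apply far
      by_contra hcon
      push Not at hcon
      exact hx (cut_const hS0 hZ0 (Or.inr hcon.le))
    have hx0 : x ≠ 0 := by rintro rfl; simp at h5; linarith
    rw [(deriv_H hsm Hu (by linarith)).2]
    have := hpde x hx0
    have h6 := fτ_nonneg hτ (hle x hx0)
    exact mul_nonneg (H0 x) (by linarith)
  obtain ⟨ia, ea⟩ := annulus (a := exp (S / 2)) (b := exp (5 * S / 2)) (exp_pos _)
    (Real.exp_le_exp.2 (by linarith))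
  rw [← Real.exp_sub, Real.log_exp] at ea
  have s3 : ∫ x, H x ^ 2 * gradSq ζ x ≤ (B ^ 2 * 25 / 4 * CZ) * (2 * V * (2 * S)) := by
    have : 2 * V * (2 * S) = 2 * V * (5 * S / 2 - S / 2) := by ring
    rw [this, ← ea, ← integral_const_mul]
    refine integral_mono i3 (ia.const_mul _) fun x => ?_
    simp only
    have hind : 0 ≤ (Icc (exp (S / 2)) (exp (5 * S / 2))).indicator (fun r : ℝ => (r ^ 2)⁻¹) ‖x‖ :=
      indicator_nonneg (fun r _ => by positivity) _
    by_cases h : gradSq ζ x = 0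
    · rw [h, mul_zero]; positivity
    · have hx0 : x ≠ 0 := by
        rintro rfl
        apply h
        have : ζ =ᶠ[𝓝 0] fun _ => 0 := by
          filter_upwards [ball_mem_nhds (0:Pl) one_pos] with y hy
          refine cut_const hS0 hZ0 (Or.inr ?_)
          have : Real.log ‖y‖ ≤ 0 := Real.log_nonpos (norm_nonneg _) (by simpa using (mem_ball_zero_iff.1 hy).le)
          linarith
        unfold gradSq
        rw [pd_congr this, pd_congr this, pd_const, pd_const]; simp
      have hn : 0 < ‖x‖ := norm_pos_iff.2 hx0
      have e : gradSq ζ x = deriv Z (Real.log ‖x‖ / S) ^ 2 / (S ^ 2 * ‖x‖ ^ 2) := cut_gradSq hZ S hx0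
      rw [e] at h ⊢
      have hr : S / 2 ≤ Real.log ‖x‖ ∧ Real.log ‖x‖ ≤ 5 * S / 2 := by
        by_contra hcon
        apply h
        rw [not_and_or, not_le, not_le] at hcon
        rw [deriv_profile hZ0 hZ2 (s := Real.log ‖x‖ / S)]
        · simp
        · rw [div_lt_iff₀ hS0, lt_div_iff₀ hS0]
          rcases hcon with hc | hc
          · left; linarith
          · right; linarith
      have hmem : ‖x‖ ∈ Icc (exp (S / 2)) (exp (5 * S / 2)) :=
        ⟨(Real.le_log_iff_exp_le hn).1 hr.1, (Real.log_le_iff_le_exp hn).1 hr.2⟩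
      rw [indicator_of_mem hmem]
      have h5 := far x hr.1
      have hHb : H x ≤ B * (5 * S / 2) := by
        rw [Hu x (by linarith)]
        exact (hB x h5.le).trans (mul_le_mul_of_nonneg_left hr.2 hB0)
      calc H x ^ 2 * (deriv Z (Real.log ‖x‖ / S) ^ 2 / (S ^ 2 * ‖x‖ ^ 2))
          ≤ (B * (5 * S / 2)) ^ 2 * (CZ / (S ^ 2 * ‖x‖ ^ 2)) := by
            have := H0 x
            gcongr
            exact hCZ _
        _ = _ := by field_simp; ring
  refine ⟨η, hηs, hηc, fun x => hA01 _, fun x hx => hA1 _ (by rw [div_le_iff₀ hS0]; linarith), i1, ?_⟩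
  calc ∫ x, gradSq η x * wf u x ^ 2 ≤ CA / S ^ 2 * ∫ x, ζ x ^ 2 * gradSq H x := s1
    _ ≤ CA / S ^ 2 * (4 * ((B ^ 2 * 25 / 4 * CZ) * (2 * V * (2 * S)))) := by
        gcongr
        exact s2.trans (mul_le_mul_of_nonneg_left s3 (by norm_num))
    _ = _ := by field_simp

lemma exists_good_ball {τ : ℝ} (hτ : 0 < τ) {u : Pl → ℝ}
    (hsm : ContDiffOn ℝ (⊤ : ℕ∞) u {(0:Pl)}ᶜ)
    (hinf : Tendsto u (cocompact Pl) atBot) :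
    ∃ (x₀ : Pl) (r f₀ s₀ : ℝ), 0 < r ∧ 0 < f₀ ∧ 0 < s₀ ∧ ∀ x ∈ ball x₀ r, x ≠ 0 ∧
      f₀ ≤ fτ τ (u x) ∧ s₀ ≤ - wf u x := by
  obtain ⟨x₀, h0, hu, hw⟩ := exists_neg_point hsm hinf
  have hs := smoothAt_ev hsm h0
  have hf := fτ_pos hτ hu
  have c1 : ContinuousAt (fun x => fτ τ (u x)) x₀ :=
    (continuous_fτ hτ).continuousAt.comp hs.continuousAt
  have c2 : ContinuousAt (fun x => - wf u x) x₀ := (smoothAt_wf hs).continuousAt.neg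
  have e1 : ∀ᶠ x in 𝓝 x₀, fτ τ (u x₀) / 2 < fτ τ (u x) :=
    c1.eventually (lt_mem_nhds (by linarith))
  have e2 : ∀ᶠ x in 𝓝 x₀, - wf u x₀ / 2 < - wf u x := c2.eventually (lt_mem_nhds (by linarith))
  have e0 : ∀ᶠ x in 𝓝 x₀, x ≠ 0 := isOpen_compl_singleton.mem_nhds h0
  obtain ⟨r, hr, h⟩ := Metric.eventually_nhds_iff_ball.1 (e0.and (e1.and e2))
  exact ⟨x₀, r, fτ τ (u x₀) / 2, - wf u x₀ / 2, hr, by linarith, by linarith, fun x hx =>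
    ⟨(h x hx).1, (h x hx).2.1.le, (h x hx).2.2.le⟩⟩

lemma int_potential {τ : ℝ} (hτ : 0 < τ) {u η v : Pl → ℝ}
    (hsm : ContDiffOn ℝ (⊤ : ℕ∞) u {(0:Pl)}ᶜ) (hη : Continuous η) (hc : HasCompactSupport η)
    (hv : Continuous v) (hv0 : v =ᶠ[𝓝 0] fun _ => 0) :
    Integrable (fun x => fτ' τ (u x) * (η x * v x) ^ 2) := by
  refine Continuous.integrable_of_hasCompactSupport ?_ ?_
  · rw [continuous_iff_continuousAt]
    intro x
    by_cases hx : x = 0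
    · subst hx
      have : (fun x => fτ' τ (u x) * (η x * v x) ^ 2) =ᶠ[𝓝 0] fun _ => 0 := by
        filter_upwards [hv0] with y hy
        rw [hy]; simp
      exact continuousAt_const.congr this.symm
    · exact ((continuous_fτ' hτ).continuousAt.comp (smoothAt_ev hsm hx).continuousAt).mul
        ((hη.mul hv).pow 2).continuousAt
  · refine HasCompactSupport.intro hc fun x hx => ?_
    rw [image_eq_zero_of_notMem_tsupport hx]; simp

set_option maxHeartbeats 1000000 in
lemma main_estimate {τ : ℝ} (hτ : 0 < τ) {ν : ℝ} (hν : 0 ≤ ν) {u : Pl → ℝ}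
    (hsm : ContDiffOn ℝ (⊤ : ℕ∞) u {(0:Pl)}ᶜ)
    (hsing : LogSing u 0 ν)
    (hpde : ∀ x : Pl, x ≠ 0 → lap u x + fτ τ (u x) = 0)
    (hL1 : Integrable (fun x : Pl => fτ τ (u x)))
    (hinf : Tendsto u (cocompact Pl) atBot) :
    ∃ φ : Pl → ℝ, ContDiff ℝ (⊤ : ℕ∞) φ ∧ HasCompactSupport φ ∧ tsupport φ ⊆ {(0:Pl)}ᶜ ∧
      ∫ x, (gradSq φ x - fτ' τ (u x) * φ x ^ 2) < 0 := by
  have hle := u_nonpos hτ hν hsm hsing hpde hinf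
  obtain ⟨x₀, r, f₀, s₀, hr, hf₀, hs₀, hball⟩ := exists_good_ball hτ hsm hinf
  obtain ⟨C, hC0, hC⟩ := exists_cutoff hτ hsm hpde hL1 hle
  set V := (volume : Measure Pl).real (ball x₀ r) with hV
  have hV0 : 0 < V := by
    rw [hV, measureReal_def]
    exact ENNReal.toReal_pos (measure_ball_pos _ _ hr).ne' measure_ball_lt_top.ne
  set c₀ := f₀ * s₀ * (exp (-1) * exp (-1)) with hc₀
  have hc₀0 : 0 < c₀ := by positivity
  set S := max 4 (max (Real.log (‖x₀‖ + r)) (2 * C / (c₀ * V) + 1)) with hS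
  have hS4 : 4 ≤ S := le_max_left _ _
  have hSl : Real.log (‖x₀‖ + r) ≤ S := (le_max_left _ _).trans (le_max_right _ _)
  have hSC : 2 * C / (c₀ * V) + 1 ≤ S := (le_max_right _ _).trans (le_max_right _ _)
  obtain ⟨η, hηs, hηc, hη01, hη1, iη, hηS⟩ := hC S hS4
  have hηb : ∀ x ∈ ball x₀ r, η x = 1 := by
    intro x hx
    apply hη1
    have h1 : ‖x‖ ≤ ‖x₀‖ + r := by
      have h2 := norm_add_le x₀ (x - x₀)
      rw [add_sub_cancel] at h2
      rw [mem_ball, dist_eq_norm] at hx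
      linarith
    exact (Real.log_le_log (norm_pos_iff.2 (hball x hx).1) h1).trans hSl
  have hgrad : ∫ x, gradSq η x * wf u x ^ 2 < c₀ * V / 2 := by
    refine lt_of_le_of_lt hηS ?_
    have hcV : 0 < c₀ * V := by positivity
    have h1 : 2 * C / (c₀ * V) < S := by linarith
    rw [div_lt_iff₀ hcV] at h1
    rw [div_lt_iff₀ (by linarith)]
    linarith
  obtain ⟨R, hR⟩ := hηc.isCompact.isBounded.subset_closedBall (0:Pl)
  obtain ⟨W, hW⟩ := wf_bdd hsm hsing R
  set K := (3 * τ + 3) / τ ^ 4 with hK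
  have hK0 : 0 < K := by positivity
  set D := (volume : Measure Pl).real (closedBall 0 R) with hD
  have hD0 : 0 ≤ D := measureReal_nonneg
  set E := K * |W| * D with hE
  have hE0 : 0 ≤ E := by positivity
  set κ := min (s₀ / 2) (c₀ * V / (4 * (E + 1))) with hκ
  have hκ0 : 0 < κ := lt_min (by linarith) (by positivity)
  have hκs : κ ≤ s₀ / 2 := min_le_left _ _
  have hκE : κ * (4 * (E + 1)) ≤ c₀ * V := by
    rw [← le_div_iff₀ (by positivity)]; exact min_le_right _ _
  obtain ⟨G, hG, hG0, hG2, hG3⟩ := exists_G κ hκ0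
  obtain ⟨hv0, hv⟩ := smooth_v hν hsm hsing hκ0 hG hG0
  set v : Pl → ℝ := fun x => G (-wf u x - κ) with hvdef
  set B : Pl → ℝ := fun x => gradSq η x * wf u x ^ 2 - (ball x₀ r).indicator (fun _ => c₀) x +
    (closedBall (0:Pl) R).indicator (fun _ => K * (κ + κ) * |W|) x with hB
  have j1 : Integrable ((ball x₀ r).indicator (fun _ => c₀) : Pl → ℝ) :=
    (integrable_indicator_iff measurableSet_ball).2 (integrableOn_const measure_ball_lt_top.ne)
  have j2 : Integrable ((closedBall (0:Pl) R).indicator (fun _ => K * (κ + κ) * |W|) : Pl → ℝ) :=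
    (integrable_indicator_iff measurableSet_closedBall).2
      (integrableOn_const measure_closedBall_lt_top.ne)
  have hBi : Integrable B := (iη.sub j1).add j2
  have hBint : ∫ x, B x < 0 := by
    have e1 : ∫ x, B x = (∫ x, gradSq η x * wf u x ^ 2) - V * c₀ + D * (K * (κ + κ) * |W|) := by
      have a1 := integral_add (iη.sub j1) j2
      have a2 := integral_sub iη j1
      rw [integral_indicator measurableSet_closedBall, setIntegral_const] at a1
      rw [integral_indicator measurableSet_ball, setIntegral_const] at a2
      simp only [smul_eq_mul] at a1 a2
      rw [← hD] at a1
      rw [← hV] at a2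
      rw [← a2]
      exact a1
    rw [e1]
    have e2 : D * (K * (κ + κ) * |W|) = 2 * κ * E := by rw [hE]; ring
    rw [e2]
    nlinarith
  refine ⟨fun x => η x * v x, hηs.mul hv, hηc.mul_right, ?_, ?_⟩
  · intro x hx h0
    rw [mem_singleton_iff] at h0
    subst h0
    refine (notMem_tsupport_iff_eventuallyEq.2 ?_) hx
    filter_upwards [hv0] with y hy
    rw [hy]; simp
  · refine lt_of_le_of_lt (quad_le (c := fun x => fτ' τ (u x)) (B := B) hηs hηc hv
      (int_potential hτ hsm hηs.continuous hηc hv.continuous hv0) hBi ?_) hBint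
    intro x
    have hb2 : 0 ≤ (closedBall (0:Pl) R).indicator (fun _ => K * (κ + κ) * |W|) x :=
      indicator_nonneg (fun _ _ => by positivity) _
    by_cases hx : x = 0
    · subst hx
      have hvz : v 0 = 0 := hv0.self_of_nhds
      have hnb : (0:Pl) ∉ ball x₀ r := fun h => (hball 0 h).1 rfl
      simp only [hB]
      rw [hvz, indicator_of_notMem hnb, wf_zero]
      simpa using hb2
    · have pb := pointwise_bound hτ hsm hpde hle hG hG2 hκ0.le hκ0.le hx
      rw [← hK] at pb
      change -(v x * (lap v x + fτ' τ (u x) * v x)) ≤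
        - 2 * (fτ τ (u x) * (v x * deriv G (-wf u x - κ))) + K * (κ + κ) * |wf u x| at pb
      have g2 := hG2 (-wf u x - κ)
      have hvn : 0 ≤ v x := g2.1
      have hvw : v x ^ 2 ≤ wf u x ^ 2 := by
        rw [← sq_abs (wf u x)]
        have h1 : v x ≤ max (-wf u x - κ) 0 := g2.2.1
        have h2 : max (-wf u x - κ) 0 ≤ |wf u x| :=
          max_le (by linarith [neg_abs_le (wf u x)]) (abs_nonneg _)
        exact pow_le_pow_left₀ hvn (h1.trans h2) 2
      have t1 : gradSq η x * v x ^ 2 ≤ gradSq η x * wf u x ^ 2 :=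
        mul_le_mul_of_nonneg_left hvw (gradSq_nonneg η x)
      have hη2 : 0 ≤ η x ^ 2 := sq_nonneg _
      have hη21 : η x ^ 2 ≤ 1 := pow_le_one₀ (hη01 x).1 (hη01 x).2
      have hmain := mul_le_mul_of_nonneg_left pb hη2
      set q := fτ τ (u x) * (v x * deriv G (-wf u x - κ)) with hq
      have hq0 : 0 ≤ q := mul_nonneg (fτ_nonneg hτ (hle x hx)) (mul_nonneg hvn g2.2.2.1)
      have t2 : η x ^ 2 * (K * (κ + κ) * |wf u x|) ≤
          (closedBall (0:Pl) R).indicator (fun _ => K * (κ + κ) * |W|) x := by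
        by_cases hm : x ∈ tsupport η
        · have hxR := hR hm
          rw [indicator_of_mem hxR]
          have h1 : |wf u x| ≤ |W| := (hW x (by simpa using hxR)).trans (le_abs_self W)
          have h2 : K * (κ + κ) * |wf u x| ≤ K * (κ + κ) * |W| := by gcongr
          have h3 : 0 ≤ K * (κ + κ) * |wf u x| := by positivity
          nlinarith
        · rw [image_eq_zero_of_notMem_tsupport hm]
          simpa using hb2
      have t3 : (ball x₀ r).indicator (fun _ => c₀) x ≤ η x ^ 2 * (2 * q) := by
        by_cases hm : x ∈ ball x₀ r
        · rw [indicator_of_mem hm, hηb x hm]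
          obtain ⟨-, b1, b2⟩ := hball x hm
          have hsx : s₀ / 2 ≤ -wf u x - κ := by linarith
          obtain ⟨g3, g4⟩ := hG3 (-wf u x - κ) (hκs.trans hsx)
          have g5 : s₀ / 2 * exp (-1) ≤ v x :=
            (mul_le_mul_of_nonneg_right hsx (exp_pos _).le).trans g3
          have g6 : f₀ * ((s₀ / 2 * exp (-1)) * exp (-1)) ≤ q := by
            rw [hq]
            exact mul_le_mul b1 (mul_le_mul g5 g4 (exp_pos _).le hvn) (by positivity) (hf₀.le.trans b1)
          have g7 : c₀ = 2 * (f₀ * ((s₀ / 2 * exp (-1)) * exp (-1))) := by rw [hc₀]; ring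
          rw [g7]; linarith
        · rw [indicator_of_notMem hm]; positivity
      simp only [hB]
      have m1 : η x ^ 2 * -(v x * (lap v x + fτ' τ (u x) * v x)) =
        - (η x ^ 2 * (v x * (lap v x + fτ' τ (u x) * v x))) := by ring
      have m2 : η x ^ 2 * (-2 * q + K * (κ + κ) * |wf u x|) =
        - (η x ^ 2 * (2 * q)) + η x ^ 2 * (K * (κ + κ) * |wf u x|) := by ring
      rw [m1, m2] at hmain
      linarith

/-- **Appendix, Proposition 7.1.** Let `ν ≥ 0` and `u` solve
`Δu + f_τ(u) = 4πν δ₀` on `ℝ²` (classically off the origin, with `u − 2ν ln|·|` smooth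
across `0`), with `f_τ(u) ∈ L¹(ℝ²)` and `u(x) → −∞` as `|x| → ∞`. Then `u` is unstable:
some smooth compactly supported test function `φ` (supported away from the origin, with
`∫ φ² = 1`) makes the quadratic form of the linearized operator negative. -/
theorem nontopological_entire_unstable
    (τ : ℝ) (hτ : 0 < τ) (ν : ℝ) (hν : 0 ≤ ν) (u : Pl → ℝ)
    (hsm : ContDiffOn ℝ (⊤ : ℕ∞) u {(0:Pl)}ᶜ)
    (hsing : LogSing u 0 ν)
    (hpde : ∀ x : Pl, x ≠ 0 → lap u x + fτ τ (u x) = 0)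
    (hL1 : Integrable (fun x : Pl => fτ τ (u x)))
    (hinf : Tendsto u (cocompact Pl) atBot) :
    ∃ φ : Pl → ℝ, ContDiff ℝ (⊤ : ℕ∞) φ ∧ HasCompactSupport φ ∧
      tsupport φ ⊆ {(0:Pl)}ᶜ ∧ (∫ x : Pl, (φ x) ^ 2) = 1 ∧
      (∫ x : Pl, (gradSq φ x - fτ' τ (u x) * (φ x) ^ 2)) < 0 := by
  obtain ⟨φ, h1, h2, h3, h4⟩ := main_estimate hτ hν hsm hsing hpde hL1 hinf
  exact normalise (c := fun x => fτ' τ (u x)) h1 h2 h3 h4
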